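/- Let k be an algebraically closed field of characteristic 2. The unipotent conjugacy class with Jordan type 3² ⊕ 1^{2n−6} (two Jordan blocks of size 3 and 2n−6 blocks of size 1) in Sp(2n, k) (n ≥ 3), and likewise in SO(2n, k), is not spherical. -/

import Mathlib

open scoped Matrix

section SphericalDefs

variable (G : Type*) [Group G] [TopologicalSpace G]

/-- A Borel subgroup of an algebraic group: a maximal closed connected solvable subgroup. -/
def IsBorel (B : Subgroup G) : Prop :=
  IsClosed (B : Set G) ∧ IsConnected (B : Set G) ∧ IsSolvable B ∧
    ∀ B' : Subgroup G, IsClosed (B' : Set G) → IsConnected (B' : Set G) → IsSolvable B' →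
      B ≤ B' → B' = B

variable {G}

/-- The orbit of `x` under conjugation by elements of a subgroup `B`. -/
def conjOrbit (B : Subgroup G) (x : G) : Set G := {g | ∃ b ∈ B, g = b * x * b⁻¹}

/-- The conjugacy class of `u`. -/
def conjClass (u : G) : Set G := {v | IsConj u v}

variable (G)

/-- A subset (typically a conjugacy class) of `G` is *spherical* if a Borel subgroup of `G`
has a dense orbit on it (acting by conjugation). -/
def IsSphericalClass (O : Set G) : Prop :=
  ∃ B : Subgroup G, IsBorel G B ∧ ∃ x ∈ O, O ⊆ closure (conjOrbit B x)

/-- A subgroup `H ≤ G` is a *spherical subgroup* if a Borel subgroup of `G` has a dense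
orbit on the homogeneous space `G ⧸ H`, i.e. `G ⧸ H` is a spherical homogeneous space. -/
def IsSphericalSubgroup (H : Subgroup G) : Prop :=
  ∃ B : Subgroup G, IsBorel G B ∧ ∃ x : G ⧸ H, Dense {y : G ⧸ H | ∃ b ∈ B, y = b • x}

end SphericalDefs

/-- The (classical) Zariski topology on the affine space `ι → k`:
a basis of open sets is given by the nonvanishing loci of polynomials. -/
def zariskiTopology (k : Type*) [CommRing k] (ι : Type*) : TopologicalSpace (ι → k) :=
  TopologicalSpace.generateFrom
    {s | ∃ p : MvPolynomial ι k, s = {v | MvPolynomial.eval v p ≠ 0}}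

/-- The Zariski topology on the general linear group `GL m k`, viewing it as an affine
variety via `g ↦ (g, g⁻¹)`. -/
instance glZariskiTopology (m k : Type*) [DecidableEq m] [Fintype m] [CommRing k] :
    TopologicalSpace (GL m k) :=
  TopologicalSpace.induced
    (fun g => Sum.elim (fun p : m × m => ((g : Matrix m m k)) p.1 p.2)
      (fun p : m × m => (((g⁻¹ : GL m k) : Matrix m m k)) p.1 p.2))
    (zariskiTopology k ((m × m) ⊕ (m × m)))

noncomputable section

variable (k : Type*) [Field k] (n : ℕ)

private lemma glInvVec {k : Type*} [Field k] {m : Type*} [DecidableEq m] [Fintype m]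
    (g : GL m k) (u : m → k) :
    (g : Matrix m m k) *ᵥ (((g⁻¹ : GL m k) : Matrix m m k) *ᵥ u) = u := by
  rw [Matrix.mulVec_mulVec, ← Units.val_mul, mul_inv_cancel, Units.val_one,
    Matrix.one_mulVec]

/-- The standard nondegenerate alternating bilinear form on `k^{2n}`. -/
def sympForm (v w : (Fin n ⊕ Fin n) → k) : k :=
  ∑ i : Fin n, (v (Sum.inl i) * w (Sum.inr i) - v (Sum.inr i) * w (Sum.inl i))

/-- The symplectic group `Sp(2n, k)`: the subgroup of `GL(2n, k)` preserving the
standard nondegenerate alternating bilinear form. -/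
def SpGroup : Subgroup (GL (Fin n ⊕ Fin n) k) where
  carrier := {g : GL (Fin n ⊕ Fin n) k | ∀ v w : (Fin n ⊕ Fin n) → k,
      sympForm k n ((g : Matrix (Fin n ⊕ Fin n) (Fin n ⊕ Fin n) k) *ᵥ v)
        ((g : Matrix (Fin n ⊕ Fin n) (Fin n ⊕ Fin n) k) *ᵥ w) = sympForm k n v w}
  mul_mem' := by
    intro a b ha hb v w
    simp only [Units.val_mul, ← Matrix.mulVec_mulVec]
    rw [ha, hb]
  one_mem' := by
    intro v w
    simp [Matrix.one_mulVec]
  inv_mem' := by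
    intro g hg v w
    conv_rhs => rw [← glInvVec g v, ← glInvVec g w, hg]

/-- The standard quadratic form of maximal Witt index on `k^{2n}`. -/
def quadForm (v : (Fin n ⊕ Fin n) → k) : k :=
  ∑ i : Fin n, v (Sum.inl i) * v (Sum.inr i)

/-- The (even) orthogonal group `O(2n, k)`: the subgroup of `GL(2n, k)` preserving the
standard quadratic form of maximal Witt index. -/
def evenOrthGroup : Subgroup (GL (Fin n ⊕ Fin n) k) where
  carrier := {g : GL (Fin n ⊕ Fin n) k | ∀ v : (Fin n ⊕ Fin n) → k,
      quadForm k n ((g : Matrix (Fin n ⊕ Fin n) (Fin n ⊕ Fin n) k) *ᵥ v) = quadForm k n v}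
  mul_mem' := by
    intro a b ha hb v
    simp only [Units.val_mul, ← Matrix.mulVec_mulVec]
    rw [ha, hb]
  one_mem' := by
    intro v
    simp [Matrix.one_mulVec]
  inv_mem' := by
    intro g hg v
    conv_rhs => rw [← glInvVec g v, hg]

/-- The special orthogonal group `SO(2n, k)` in characteristic 2: the connected component
of the identity of `O(2n, k)` in the Zariski topology.  (The connected component of the
identity of a group with translation-continuous topology is a subgroup, so taking
`Subgroup.closure` does not change the underlying set.) -/
def evenSOGroup : Subgroup (GL (Fin n ⊕ Fin n) k) :=
  Subgroup.closure ((↑) '' (connectedComponent (1 : evenOrthGroup k n)))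

/-- A unipotent element (of a subgroup of `GL(2n, k)`) has Jordan type `3² ⊕ 1^{2n-6}`:
two Jordan blocks of size 3 and `2n - 6` blocks of size 1.  This is equivalent to the
stated rank conditions on `N = u - 1`. -/
def hasJordanType33 {k : Type*} [Field k] {n : ℕ} (H : Subgroup (GL (Fin n ⊕ Fin n) k))
    (u : H) : Prop :=
  letI N : Matrix (Fin n ⊕ Fin n) (Fin n ⊕ Fin n) k :=
    ((u : GL (Fin n ⊕ Fin n) k) : Matrix (Fin n ⊕ Fin n) (Fin n ⊕ Fin n) k) - 1
  N ^ 3 = 0 ∧ N.rank = 4 ∧ (N ^ 2).rank = 2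

section RegularFunctions

variable {m K : Type*} [DecidableEq m] [Fintype m] [Field K]

/-- The coordinate functions on `GL m K`: the entries of `g` and of `g⁻¹`. -/
def glCoord (p : (m × m) ⊕ (m × m)) (g : GL m K) : K :=
  Sum.elim (fun p : m × m => (g : Matrix m m K) p.1 p.2)
    (fun p : m × m => ((g⁻¹ : GL m K) : Matrix m m K) p.1 p.2) p

variable (m K) in
/-- The algebra of regular functions on `GL m K`. -/
def regularFun : Subalgebra K (GL m K → K) :=
  Algebra.adjoin K (Set.range glCoord)

lemma regularFun_entry (i j : m) :
    (fun g : GL m K => (g : Matrix m m K) i j) ∈ regularFun m K :=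
  Algebra.subset_adjoin ⟨Sum.inl (i, j), rfl⟩

lemma regularFun_inv_entry (i j : m) :
    (fun g : GL m K => ((g⁻¹ : GL m K) : Matrix m m K) i j) ∈ regularFun m K :=
  Algebra.subset_adjoin ⟨Sum.inr (i, j), rfl⟩

lemma regularFun_const (c : K) : (fun _ : GL m K => c) ∈ regularFun m K :=
  (regularFun m K).algebraMap_mem c

lemma aeval_glCoord_apply (p : MvPolynomial ((m × m) ⊕ (m × m)) K) (g : GL m K) :
    MvPolynomial.aeval (glCoord (m := m) (K := K)) p g =
      MvPolynomial.eval (fun i => glCoord i g) p := by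
  induction p using MvPolynomial.induction_on with
  | C a => simp
  | add p q hp hq => simp [hp, hq]
  | mul_X p i hp => simp [hp]

lemma mem_regularFun_iff {f : GL m K → K} :
    f ∈ regularFun m K ↔ ∃ p : MvPolynomial ((m × m) ⊕ (m × m)) K,
      ∀ g, f g = MvPolynomial.eval (fun i => glCoord i g) p := by
  rw [regularFun, Algebra.adjoin_range_eq_range_aeval]
  constructor
  · rintro ⟨p, rfl⟩
    exact ⟨p, fun g => aeval_glCoord_apply p g⟩
  · rintro ⟨p, hp⟩
    exact ⟨p, funext fun g => by rw [hp]; exact aeval_glCoord_apply p g⟩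

lemma isClosed_regularFun_zeros {f : GL m K → K} (hf : f ∈ regularFun m K) :
    IsClosed {g | f g = 0} := by
  obtain ⟨p, hp⟩ := mem_regularFun_iff.1 hf
  rw [← isOpen_compl_iff]
  refine ⟨{v | MvPolynomial.eval v p ≠ 0}, TopologicalSpace.GenerateOpen.basic _ ⟨p, rfl⟩, ?_⟩
  ext g
  simp only [Set.mem_preimage, Set.mem_ofPred_eq, Set.mem_compl_iff, hp]
  rfl

lemma isClosed_regularFun_fiber {f : GL m K → K} (hf : f ∈ regularFun m K) (c : K) :
    IsClosed {g | f g = c} := by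
  have := isClosed_regularFun_zeros (sub_mem hf (regularFun_const c))
  simpa [sub_eq_zero] using this

/-- A regular function with finitely many values on a preconnected set is constant there. -/
lemma regularFun_eq_of_finite {f : GL m K → K} (hf : f ∈ regularFun m K) {s : Set (GL m K)}
    (hs : IsPreconnected s) (hfin : (f '' s).Finite) {x y : GL m K} (hx : x ∈ s) (hy : y ∈ s) :
    f x = f y := by
  by_contra hne
  have hclosed : IsClosed (⋃ c ∈ (f '' s) \ {f x}, {g | f g = c}) :=
    (hfin.subset Set.sdiff_subset).isClosed_biUnion fun c _ => isClosed_regularFun_fiber hf c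
  obtain ⟨z, hz, hz1, hz2⟩ := isPreconnected_closed_iff.1 hs _ _
    (isClosed_regularFun_fiber hf (f x)) hclosed
    (fun z hz => by
      by_cases h : f z = f x
      · exact Or.inl h
      · exact Or.inr (Set.mem_biUnion (x := f z) ⟨⟨z, hz, rfl⟩, h⟩ rfl))
    ⟨x, hx, rfl⟩
    ⟨y, hy, Set.mem_biUnion (x := f y) ⟨⟨y, hy, rfl⟩, fun h => hne h.symm⟩ rfl⟩
  simp only [Set.mem_iUnion] at hz2
  obtain ⟨c, hc, hzc⟩ := hz2
  exact hc.2 (hzc ▸ hz1)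

/-- A self-map of `GL m K` is regular if its entries and those of its inverse are. -/
def IsRegularMap (φ : GL m K → GL m K) : Prop :=
  ∀ i j, (fun g => (φ g : Matrix m m K) i j) ∈ regularFun m K ∧
    (fun g => ((φ g)⁻¹.1 : Matrix m m K) i j) ∈ regularFun m K

lemma IsRegularMap.id : IsRegularMap (fun g : GL m K => g) :=
  fun i j => ⟨regularFun_entry i j, regularFun_inv_entry i j⟩

lemma IsRegularMap.const (h : GL m K) : IsRegularMap (fun _ : GL m K => h) :=
  fun _ _ => ⟨regularFun_const _, regularFun_const _⟩

lemma IsRegularMap.inv {φ : GL m K → GL m K} (h : IsRegularMap φ) :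
    IsRegularMap (fun g => (φ g)⁻¹) :=
  fun i j => ⟨(h i j).2, by simpa using (h i j).1⟩

lemma IsRegularMap.mul {φ ψ : GL m K → GL m K} (hφ : IsRegularMap φ) (hψ : IsRegularMap ψ) :
    IsRegularMap (fun g => φ g * ψ g) := by
  intro i j
  constructor
  · have := Subalgebra.sum_mem (regularFun m K) (t := Finset.univ)
      (f := fun l => (fun g => (φ g : Matrix m m K) i l) * (fun g => (ψ g : Matrix m m K) l j))
      fun l _ => mul_mem (hφ i l).1 (hψ l j).1
    convert this using 1
    funext g
    simp [Matrix.mul_apply]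
  · have := Subalgebra.sum_mem (regularFun m K) (t := Finset.univ)
      (f := fun l => (fun g => ((ψ g)⁻¹.1 : Matrix m m K) i l) *
        (fun g => ((φ g)⁻¹.1 : Matrix m m K) l j))
      fun l _ => mul_mem (hψ i l).2 (hφ l j).2
    convert this using 1
    funext g
    rw [mul_inv_rev]
    simp [Matrix.mul_apply, -Matrix.coe_units_inv]

lemma IsRegularMap.comp_mem {φ : GL m K → GL m K} (hφ : IsRegularMap φ) {f : GL m K → K}
    (hf : f ∈ regularFun m K) : (fun g => f (φ g)) ∈ regularFun m K := by
  induction hf using Algebra.adjoin_induction with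
  | mem f hf =>
    obtain ⟨p | p, rfl⟩ := hf
    · exact (hφ p.1 p.2).1
    · exact (hφ p.1 p.2).2
  | algebraMap r => exact regularFun_const r
  | add f g _ _ hf hg => exact add_mem hf hg
  | mul f g _ _ hf hg => exact mul_mem hf hg

lemma IsRegularMap.continuous {φ : GL m K → GL m K} (hφ : IsRegularMap φ) : Continuous φ := by
  refine continuous_induced_rng.2 (continuous_generateFrom_iff.2 ?_)
  rintro _ ⟨p, rfl⟩
  have hp : (fun g => MvPolynomial.eval (fun i => glCoord i g) p) ∈ regularFun m K :=
    mem_regularFun_iff.2 ⟨p, fun _ => rfl⟩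
  exact (isClosed_regularFun_zeros (hφ.comp_mem hp)).isOpen_compl

lemma isPreconnected_closure_of_forall {C : Set (GL m K)}
    (h : ∀ c ∈ C, ∃ t ⊆ (Subgroup.closure C : Set (GL m K)), 1 ∈ t ∧ c ∈ t ∧ IsPreconnected t) :
    IsPreconnected (Subgroup.closure C : Set (GL m K)) := by
  refine isPreconnected_of_forall 1 fun y hy => ?_
  induction hy using Subgroup.closure_induction with
  | mem x hx => exact h x hx
  | one => exact ⟨{1}, by simp [one_mem], rfl, rfl, isPreconnected_singleton⟩
  | mul x y hx hy hx' hy' =>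
    obtain ⟨s, hs, hs1, hsx, hsc⟩ := hx'
    obtain ⟨t, ht, ht1, hty, htc⟩ := hy'
    refine ⟨s ∪ (fun g => x * g) '' t, ?_, Or.inl hs1, Or.inr ⟨y, hty, rfl⟩, ?_⟩
    · rintro _ (hz | ⟨z, hz, rfl⟩)
      · exact hs hz
      · exact mul_mem hx (ht hz)
    · exact hsc.union x hsx ⟨1, ht1, by simp⟩
        (htc.image _ ((IsRegularMap.const x).mul IsRegularMap.id).continuous.continuousOn)
  | inv x hx hx' =>
    obtain ⟨s, hs, hs1, hsx, hsc⟩ := hx'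
    refine ⟨(fun g => x⁻¹ * g) '' s, ?_, ⟨x, hsx, by simp⟩, ⟨1, hs1, by simp⟩,
      hsc.image _ ((IsRegularMap.const _).mul IsRegularMap.id).continuous.continuousOn⟩
    rintro _ ⟨z, hz, rfl⟩
    exact mul_mem (inv_mem hx) (hs hz)

lemma isPreconnected_commutator {Γ : Subgroup (GL m K)} (hΓ : IsPreconnected (Γ : Set (GL m K))) :
    IsPreconnected ((⁅Γ, Γ⁆ : Subgroup (GL m K)) : Set (GL m K)) := by
  rw [Subgroup.commutator_def]
  refine isPreconnected_closure_of_forall ?_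
  rintro _ ⟨a, ha, b, hb, rfl⟩
  refine ⟨(fun g => g * b * g⁻¹ * b⁻¹) '' Γ, ?_, ⟨1, one_mem _, by simp⟩, ⟨a, ha, rfl⟩,
    hΓ.image _ (((IsRegularMap.id.mul (.const b)).mul IsRegularMap.id.inv).mul
      (.const b⁻¹)).continuous.continuousOn⟩
  rintro _ ⟨g, hg, rfl⟩
  exact Subgroup.subset_closure ⟨g, hg, b, hb, rfl⟩

end RegularFunctions

section LieKolchin

open Module
open scoped commutatorElement

lemma exists_common_eigenvector_of_commute {K V ι : Type*} [Field K] [IsAlgClosed K]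
    [AddCommGroup V] [Module K V] [FiniteDimensional K V] (T : ι → End K V) (d : ℕ) :
    ∀ E : Submodule K V, finrank K E ≤ d → E ≠ ⊥ → (∀ i, ∀ v ∈ E, T i v ∈ E) →
      (∀ i j, ∀ v ∈ E, T i (T j v) = T j (T i v)) →
      ∃ v ∈ E, v ≠ 0 ∧ ∀ i, ∃ c : K, T i v = c • v := by
  induction d with
  | zero =>
    intro E hd hE
    exact absurd (Submodule.finrank_eq_zero.1 (Nat.le_zero.1 hd)) hE
  | succ d ih =>
    intro E hd hE hst hcomm
    by_cases hscal : ∀ i, ∃ c : K, ∀ v ∈ E, T i v = c • v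
    · obtain ⟨v, hv, hv0⟩ := Submodule.exists_mem_ne_zero_of_ne_bot hE
      exact ⟨v, hv, hv0, fun i => (hscal i).imp fun c hc => hc v hv⟩
    · push Not at hscal
      obtain ⟨i, hi⟩ := hscal
      have : Nontrivial E := Submodule.nontrivial_iff_ne_bot.2 hE
      obtain ⟨μ, hμ⟩ := End.exists_eigenvalue ((T i).restrict (hst i))
      obtain ⟨x, hx⟩ := hμ.exists_hasEigenvector
      have hxμ : T i x = μ • (x : V) := by
        simpa using congrArg (Subtype.val) hx.apply_eq_smul
      obtain ⟨y, hy, hyμ⟩ := hi μ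
      let F : Submodule K V := E ⊓ LinearMap.ker (T i - μ • LinearMap.id)
      have hF : ∀ v, v ∈ F ↔ v ∈ E ∧ T i v = μ • v := by
        intro v
        simp [F, sub_eq_zero]
      have hlt : F < E := lt_of_le_of_ne inf_le_left fun h =>
        hyμ ((hF y).1 (h ▸ hy)).2
      obtain ⟨v, hv, h⟩ := ih F
        (by have := Submodule.finrank_lt_finrank_of_lt hlt; omega)
        (fun h => hx.2 (by
          have : (x : V) ∈ F := (hF x).2 ⟨x.2, hxμ⟩
          rw [h, Submodule.mem_bot] at this
          exact Subtype.ext this))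
        (fun j v hv => (hF _).2 ⟨hst j v ((hF v).1 hv).1, by
          rw [hcomm i j v ((hF v).1 hv).1, ((hF v).1 hv).2, map_smul]⟩)
        (fun j l v hv => hcomm j l v ((hF v).1 hv).1)
      exact ⟨v, ((hF v).1 hv).1, h⟩

variable {m K : Type*} [DecidableEq m] [Fintype m] [Field K]

/-- A representation of a subgroup of `GL m K` whose matrix coefficients are restrictions of
regular functions. -/
def IsRationalRep (Γ : Subgroup (GL m K)) {V : Type*} [AddCommGroup V] [Module K V]
    (ρ : Γ →* End K V) : Prop :=
  ∀ (φ : Dual K V) (v : V), ∃ f ∈ regularFun m K, ∀ γ : Γ, f γ = φ (ρ γ v)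

/-- Every nonzero finite-dimensional rational representation has a common eigenvector. -/
def HasCommonEigenvectors.{w} (Γ : Subgroup (GL m K)) : Prop :=
  ∀ (V : Type w) [AddCommGroup V] [Module K V] [FiniteDimensional K V] [Nontrivial V]
    (ρ : Γ →* End K V), IsRationalRep Γ ρ → ∃ v : V, v ≠ 0 ∧ ∀ γ : Γ, ∃ c : K, ρ γ v = c • v

lemma finite_pow_eq_one {K : Type*} [Field K] {d : ℕ} (hd : d ≠ 0) :
    {c : K | c ^ d = 1}.Finite := by
  refine (Polynomial.nthRootsFinset d (1 : K)).finite_toSet.subset fun c hc => ?_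
  simpa [Polynomial.mem_nthRootsFinset (Nat.pos_of_ne_zero hd)] using hc

lemma HasCommonEigenvectors.of_commutator.{w} [IsAlgClosed K] {Γ : Subgroup (GL m K)}
    (hΓ : IsPreconnected (Γ : Set (GL m K))) (h : HasCommonEigenvectors.{_, _, w} ⁅Γ, Γ⁆) :
    HasCommonEigenvectors.{_, _, w} Γ := by
  intro V _ _ _ _ ρ hρ
  have hD : ⁅Γ, Γ⁆ ≤ Γ := Subgroup.commutator_le.2 fun a ha b hb => by
    rw [commutatorElement_def]
    exact mul_mem (mul_mem (mul_mem ha hb) (inv_mem ha)) (inv_mem hb)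
  obtain ⟨v₀, hv₀, hχ⟩ := h V (ρ.comp (Subgroup.inclusion hD)) fun φ v => by
    obtain ⟨f, hf, hfv⟩ := hρ φ v
    exact ⟨f, hf, fun γ => hfv (Subgroup.inclusion hD γ)⟩
  obtain ⟨φ, hφ⟩ := Projective.exists_dual_eq_one K hv₀
  obtain ⟨f, hf, hfv⟩ := hρ φ v₀
  have hinv : ∀ h : Γ, ∀ v, ρ h⁻¹ (ρ h v) = v := fun h v => by
    rw [← End.mul_apply, ← map_mul, inv_mul_cancel, map_one, End.one_apply]
  have hf0 : ∀ g : Γ, (g : GL m K) ∈ ⁅Γ, Γ⁆ → ρ g v₀ = f g • v₀ := by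
    intro g hg
    obtain ⟨c, hc⟩ := hχ ⟨g, hg⟩
    have hc' : ρ g v₀ = c • v₀ := hc
    rw [hfv, hc', map_smul, hφ, smul_eq_mul, mul_one]
  have hconj : ∀ g : Γ, (g : GL m K) ∈ ⁅Γ, Γ⁆ → ∀ h : Γ,
      ((h⁻¹ * g * h : Γ) : GL m K) ∈ ⁅Γ, Γ⁆ := by
    intro g hg h
    have h1 : ((h⁻¹ * g * h : Γ) : GL m K) = ⁅(h⁻¹ : GL m K), (g : GL m K)⁆ * g := by
      simp [commutatorElement_def, mul_assoc]
    rw [h1]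
    exact mul_mem (Subgroup.commutator_mem_commutator (inv_mem h.2) g.2) hg
  have hfconj : ∀ g : Γ, (g : GL m K) ∈ ⁅Γ, Γ⁆ → ∀ h : Γ,
      f ((h : GL m K)⁻¹ * g * h) = f g := by
    intro g hg h
    have hreg : (fun x : GL m K => f (x⁻¹ * g * x)) ∈ regularFun m K :=
      ((IsRegularMap.id.inv.mul (.const (g : GL m K))).mul IsRegularMap.id).comp_mem hf
    have := regularFun_eq_of_finite hreg hΓ
      ((End.finite_hasEigenvalue (ρ g)).subset ?_) h.2 (one_mem Γ)
    · simpa using this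
    · rintro _ ⟨x, hx, rfl⟩
      have hx' := hf0 _ (hconj g hg ⟨x, hx⟩)
      refine End.hasEigenvalue_of_hasEigenvector (x := ρ ⟨x, hx⟩ v₀)
        ⟨End.mem_eigenspace_iff.2 ?_, fun h0 => hv₀ ?_⟩
      · rw [← End.mul_apply, ← map_mul]
        have : g * ⟨x, hx⟩ = ⟨x, hx⟩ * ((⟨x, hx⟩ : Γ)⁻¹ * g * ⟨x, hx⟩) := by
          simp [mul_assoc]
        rw [this, map_mul, End.mul_apply, hx', map_smul]
        rfl
      · rw [← hinv ⟨x, hx⟩ v₀, h0, map_zero]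
  let E : Submodule K V :=
    ⨅ g : {g : Γ // (g : GL m K) ∈ ⁅Γ, Γ⁆}, LinearMap.ker (ρ g - f g.1 • LinearMap.id)
  have hE : ∀ v, v ∈ E ↔ ∀ g : Γ, (g : GL m K) ∈ ⁅Γ, Γ⁆ → ρ g v = f g • v := by
    intro v
    simp [E, sub_eq_zero]
  have hEst : ∀ h : Γ, ∀ v ∈ E, ρ h v ∈ E := by
    intro h v hv
    rw [hE] at hv ⊢
    intro g hg
    rw [← End.mul_apply, ← map_mul, show g * h = h * (h⁻¹ * g * h) by simp [mul_assoc], map_mul,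
      End.mul_apply, hv _ (hconj g hg h), map_smul]
    congr 1
    exact hfconj g hg h
  have hE0 : E ≠ ⊥ := fun h => hv₀ (by
    have : v₀ ∈ E := (hE v₀).2 hf0
    rwa [h, Submodule.mem_bot] at this)
  have : Nontrivial E := Submodule.nontrivial_iff_ne_bot.2 hE0
  let σ : Γ → End K E := fun h => (ρ h).restrict (hEst h)
  have hσ : ∀ h, LinearMap.det (σ h) ≠ 0 := by
    intro h h0
    have h1 : σ h⁻¹ * σ h = 1 := by
      ext v
      exact hinv h v
    have h2 := congrArg LinearMap.det h1
    rw [map_mul, h0, mul_zero, map_one] at h2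
    exact zero_ne_one h2
  have hmem : ∀ h h' : Γ, ((⁅h, h'⁆ : Γ) : GL m K) ∈ ⁅Γ, Γ⁆ := fun h h' =>
    Subgroup.commutator_mem_commutator h.2 h'.2
  have hswap : ∀ h h' : Γ, ∀ v ∈ E, ρ h (ρ h' v) = f (⁅h, h'⁆ : Γ) • ρ h' (ρ h v) := by
    intro h h' v hv
    rw [← (hE _).1 (hEst h' _ (hEst h v hv)) _ (hmem h h')]
    simp only [← End.mul_apply, ← map_mul]
    congr 2
    simp [commutatorElement_def, mul_assoc]
  have hone : ∀ h h' : Γ, f (⁅h, h'⁆ : Γ) = 1 := by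
    intro h h'
    have hreg : (fun x : GL m K => f (x * h' * x⁻¹ * (h' : GL m K)⁻¹)) ∈ regularFun m K :=
      (((IsRegularMap.id.mul (.const (h' : GL m K))).mul IsRegularMap.id.inv).mul
        (.const (h' : GL m K)⁻¹)).comp_mem hf
    have hf1 : f 1 = 1 := by
      have := hfv 1
      rwa [map_one, End.one_apply, hφ] at this
    have := regularFun_eq_of_finite hreg hΓ
      ((finite_pow_eq_one (K := K) (finrank_pos (R := K) (M := E)).ne').subset ?_)
      h.2 (one_mem Γ)
    · simpa [hf1, commutatorElement_def] using this
    · rintro _ ⟨x, hx, rfl⟩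
      have h1 : σ ⟨x, hx⟩ * σ h' = f (⁅(⟨x, hx⟩ : Γ), h'⁆ : Γ) • (σ h' * σ ⟨x, hx⟩) := by
        ext v
        exact hswap _ _ v v.2
      have h2 := congrArg LinearMap.det h1
      rw [LinearMap.det_smul, map_mul, map_mul, mul_comm (LinearMap.det (σ h'))] at h2
      exact (mul_eq_right₀ (mul_ne_zero (hσ _) (hσ _))).1 h2.symm
  obtain ⟨v, -, hv0, hv⟩ := exists_common_eigenvector_of_commute (fun h : Γ => ρ h) _ E le_rfl hE0
    hEst fun h h' v hv => by
      rw [hswap h h' v hv, hone, one_smul]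
  exact ⟨v, hv0, hv⟩

/-- The **Lie–Kolchin theorem** for connected solvable subgroups of `GL m K`. -/
theorem hasCommonEigenvectors_of_isSolvable.{w} [IsAlgClosed K] (Γ : Subgroup (GL m K))
    (hΓ : IsPreconnected (Γ : Set (GL m K))) [hsol : Group.IsSolvable Γ] :
    HasCommonEigenvectors.{_, _, w} Γ := by
  obtain ⟨N, hN⟩ := hsol.solvable
  let D : ℕ → Subgroup (GL m K) := fun i => (derivedSeries Γ i).map Γ.subtype
  have hD : ∀ i, D (i + 1) = ⁅D i, D i⁆ := fun i => by
    simp only [D, derivedSeries_succ, Subgroup.map_commutator]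
  have hD0 : D 0 = Γ := by simp [D, ← MonoidHom.range_eq_map]
  have hconn : ∀ i, IsPreconnected (D i : Set (GL m K)) := fun i => by
    induction i with
    | zero => rwa [hD0]
    | succ i ih => rw [hD]; exact isPreconnected_commutator ih
  have hbase : HasCommonEigenvectors.{_, _, w} (D N) := by
    intro V _ _ _ _ ρ _
    obtain ⟨v, hv⟩ := exists_ne (0 : V)
    refine ⟨v, hv, fun γ => ⟨1, ?_⟩⟩
    have hγ : γ = 1 := by
      have := γ.2
      simp only [D, hN, Subgroup.map_bot, Subgroup.mem_bot] at this
      exact Subtype.ext this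
    rw [hγ, map_one, End.one_apply, one_smul]
  have hall : ∀ j, ∀ i, i + j = N → HasCommonEigenvectors.{_, _, w} (D i) := by
    intro j
    induction j with
    | zero => rintro i rfl; exact hbase
    | succ j ih =>
      intro i hi
      exact .of_commutator (hconn i) (hD i ▸ ih (i + 1) (by omega))
  exact hD0 ▸ hall N 0 (zero_add N)

end LieKolchin

section StableSubspaces

open Module

universe u v

variable {m : Type u} {K : Type v} [DecidableEq m] [Fintype m] [Field K]

lemma regularFun_mulVec (ψ : Dual K (m → K)) (y : m → K) :
    (fun g : GL m K => ψ ((g : Matrix m m K) *ᵥ y)) ∈ regularFun m K := by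
  have := Subalgebra.sum_mem (regularFun m K) (t := Finset.univ)
    (f := fun i => (∑ j, (fun g : GL m K => (g : Matrix m m K) i j) * fun _ => y j) *
      fun _ => ψ (Pi.single i 1))
    fun i _ => mul_mem
      (sum_mem fun j _ => mul_mem (regularFun_entry i j) (regularFun_const _))
      (regularFun_const _)
  convert this using 1
  funext g
  rw [LinearMap.pi_apply_eq_sum_univ]
  have hsingle (i : m) : (fun j => if i = j then (1 : K) else 0) = Pi.single i 1 := by
    funext j
    simp [Pi.single_apply, eq_comm]
  simp [Matrix.mulVec, dotProduct, hsingle]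

/-- `X` is stable under the natural action of `Γ` on `m → K`. -/
def IsStableSubspace (Γ : Subgroup (GL m K)) (X : Submodule K (m → K)) : Prop :=
  ∀ g ∈ Γ, ∀ v ∈ X, (g : Matrix m m K) *ᵥ v ∈ X

/-- The action of a subgroup of `GL m K` on a stable subspace modulo a stable subspace. -/
def subquotientRep {Γ : Subgroup (GL m K)} {X Y : Submodule K (m → K)}
    (hX : IsStableSubspace Γ X) (hY : IsStableSubspace Γ Y) :
    Γ →* End K (Y ⧸ X.submoduleOf Y) where
  toFun γ := (X.submoduleOf Y).mapQ (X.submoduleOf Y)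
    ((Matrix.mulVecLin (γ : GL m K).1).restrict fun v hv => hY γ γ.2 v hv)
    fun v hv => hX γ γ.2 v hv
  map_one' := by
    ext v
    simp [LinearMap.restrict_apply]
  map_mul' γ γ' := by
    refine Submodule.linearMap_qext _ (LinearMap.ext fun v => ?_)
    exact congrArg (Submodule.mkQ (X.submoduleOf Y))
      (Subtype.ext (Matrix.mulVec_mulVec (v : m → K) (γ : GL m K).1 (γ' : GL m K).1).symm)

lemma isRationalRep_subquotientRep {Γ : Subgroup (GL m K)} {X Y : Submodule K (m → K)}
    (hX : IsStableSubspace Γ X) (hY : IsStableSubspace Γ Y) :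
    IsRationalRep Γ (subquotientRep hX hY) := by
  intro φ v
  obtain ⟨y, rfl⟩ := Submodule.mkQ_surjective _ v
  obtain ⟨ψ, hψ⟩ := LinearMap.exists_extend (φ ∘ₗ (X.submoduleOf Y).mkQ)
  refine ⟨_, regularFun_mulVec ψ y, fun γ => ?_⟩
  exact LinearMap.congr_fun hψ ⟨_, hY γ γ.2 y y.2⟩

lemma HasCommonEigenvectors.exists_stable_extension {Γ : Subgroup (GL m K)}
    (hΓ : HasCommonEigenvectors.{_, _, max u v} Γ) {X Y : Submodule K (m → K)}
    (hX : IsStableSubspace Γ X) (hY : IsStableSubspace Γ Y) (hXY : X < Y) :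
    ∃ v ∈ Y, IsStableSubspace Γ (X ⊔ K ∙ v) ∧ finrank K ↥(X ⊔ K ∙ v) = finrank K X + 1 := by
  have : Nontrivial (Y ⧸ X.submoduleOf Y) :=
    Submodule.Quotient.nontrivial_iff.2 fun h =>
      hXY.not_ge (Submodule.submoduleOf_eq_top.1 h)
  obtain ⟨v, hv0, hv⟩ := hΓ _ _ (isRationalRep_subquotientRep hX hY)
  obtain ⟨y, rfl⟩ := Submodule.mkQ_surjective _ v
  have hyX : (y : m → K) ∉ X := fun h => hv0 ((Submodule.Quotient.mk_eq_zero _).2 h)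
  refine ⟨y, y.2, ?_, ?_⟩
  · intro g hg z hz
    obtain ⟨x, hx, w, hw, rfl⟩ := Submodule.mem_sup.1 hz
    obtain ⟨a, rfl⟩ := Submodule.mem_span_singleton.1 hw
    obtain ⟨c, hc⟩ := hv ⟨g, hg⟩
    have hc' : (g : Matrix m m K) *ᵥ (y : m → K) - c • (y : m → K) ∈ X :=
      (Submodule.Quotient.eq (X.submoduleOf Y)
        (x := ⟨_, hY g hg y y.2⟩) (y := c • y)).1 hc
    rw [Matrix.mulVec_add, Matrix.mulVec_smul]
    refine add_mem (Submodule.mem_sup_left (hX g hg x hx)) (Submodule.smul_mem _ _ ?_)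
    have : (g : Matrix m m K) *ᵥ (y : m → K) =
        ((g : Matrix m m K) *ᵥ (y : m → K) - c • (y : m → K)) + c • (y : m → K) := by simp
    rw [this]
    exact Submodule.add_mem_sup hc' (Submodule.smul_mem _ _ (Submodule.mem_span_singleton_self _))
  · have hy0 : (y : m → K) ≠ 0 := fun h => hyX (h ▸ zero_mem X)
    have h := Submodule.finrank_sup_add_finrank_inf_eq X (K ∙ (y : m → K))
    rw [finrank_span_singleton hy0] at h
    have hinf : X ⊓ K ∙ (y : m → K) = ⊥ := by
      rw [← disjoint_iff, Submodule.disjoint_span_singleton' hy0]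
      exact hyX
    rw [hinf, finrank_bot] at h
    exact h

lemma isStableSubspace_bot (Γ : Subgroup (GL m K)) : IsStableSubspace Γ ⊥ := by
  intro g _ v hv
  rw [Submodule.mem_bot] at hv ⊢
  rw [hv, Matrix.mulVec_zero]

end StableSubspaces

section SymplecticForm

open Module

variable {k n}

/-- `sympForm` as a bilinear form. -/
def sympBilin : LinearMap.BilinForm k ((Fin n ⊕ Fin n) → k) :=
  LinearMap.mk₂ k (sympForm k n)
    (fun v v' w => by
      simp only [sympForm, Pi.add_apply, ← Finset.sum_add_distrib]
      exact Finset.sum_congr rfl fun i _ => by ring)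
    (fun c v w => by
      simp only [sympForm, Pi.smul_apply, smul_eq_mul, Finset.mul_sum]
      exact Finset.sum_congr rfl fun i _ => by ring)
    (fun v w w' => by
      simp only [sympForm, Pi.add_apply, ← Finset.sum_add_distrib]
      exact Finset.sum_congr rfl fun i _ => by ring)
    (fun c v w => by
      simp only [sympForm, Pi.smul_apply, smul_eq_mul, Finset.mul_sum]
      exact Finset.sum_congr rfl fun i _ => by ring)

lemma sympBilin_apply (v w : (Fin n ⊕ Fin n) → k) : sympBilin v w = sympForm k n v w := rfl

lemma sympBilin_isAlt :
    (sympBilin : LinearMap.BilinForm k ((Fin n ⊕ Fin n) → k)).IsAlt := fun v => by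
  simp [sympBilin_apply, sympForm, mul_comm]

lemma sympBilin_isRefl : (sympBilin : LinearMap.BilinForm k ((Fin n ⊕ Fin n) → k)).IsRefl :=
  sympBilin_isAlt.isRefl

lemma sympBilin_nondegenerate :
    (sympBilin : LinearMap.BilinForm k ((Fin n ⊕ Fin n) → k)).Nondegenerate := by
  have hrefl : LinearMap.IsRefl (sympBilin (k := k) (n := n)) := fun _ _ h => sympBilin_isRefl _ _ h
  rw [LinearMap.BilinForm.Nondegenerate, hrefl.nondegenerate_iff_separatingLeft]
  intro v hv
  funext i
  rcases i with i | i
  · have := hv (Pi.single (Sum.inr i) 1)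
    simpa [sympBilin_apply, sympForm, Pi.single_apply] using this
  · have := hv (Pi.single (Sum.inl i) 1)
    simpa [sympBilin_apply, sympForm, Pi.single_apply] using this

lemma mem_SpGroup_iff {g : GL (Fin n ⊕ Fin n) k} :
    g ∈ SpGroup k n ↔ ∀ v w, sympBilin (g.1 *ᵥ v) (g.1 *ᵥ w) = sympBilin v w := Iff.rfl

lemma mem_evenOrthGroup_iff {g : GL (Fin n ⊕ Fin n) k} :
    g ∈ evenOrthGroup k n ↔ ∀ v, quadForm k n (g.1 *ᵥ v) = quadForm k n v := Iff.rfl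

lemma quadForm_smul (c : k) (v : (Fin n ⊕ Fin n) → k) :
    quadForm k n (c • v) = c ^ 2 * quadForm k n v := by
  simp only [quadForm, Pi.smul_apply, smul_eq_mul, Finset.mul_sum]
  exact Finset.sum_congr rfl fun i _ => by ring

lemma quadForm_add [CharP k 2] (v w : (Fin n ⊕ Fin n) → k) :
    quadForm k n (v + w) = quadForm k n v + quadForm k n w + sympBilin v w := by
  simp only [quadForm, sympBilin_apply, sympForm, Pi.add_apply, ← Finset.sum_add_distrib,
    CharTwo.sub_eq_add]
  exact Finset.sum_congr rfl fun i _ => by ring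

lemma sympBilin_comm [CharP k 2] (v w : (Fin n ⊕ Fin n) → k) : sympBilin v w = sympBilin w v := by
  rw [← sympBilin_isAlt.neg_eq, CharTwo.neg_eq]

lemma evenOrthGroup_le_SpGroup [CharP k 2] : evenOrthGroup k n ≤ SpGroup k n := by
  intro g hg
  rw [mem_evenOrthGroup_iff] at hg
  rw [mem_SpGroup_iff]
  intro v w
  have h := hg (v + w)
  rw [Matrix.mulVec_add, quadForm_add, quadForm_add, hg, hg] at h
  exact add_left_cancel h

lemma finrank_orthogonal_sympBilin (X : Submodule k ((Fin n ⊕ Fin n) → k)) :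
    finrank k (sympBilin.orthogonal X) = 2 * n - finrank k X := by
  rw [LinearMap.BilinForm.finrank_orthogonal sympBilin_nondegenerate]
  simp [two_mul]

lemma exists_sympBilin_ne_zero {a w : (Fin n ⊕ Fin n) → k} (h : a ∉ k ∙ w) :
    ∃ z, sympBilin a z ≠ 0 ∧ sympBilin z w = 0 := by
  by_contra! hcon
  apply h
  rw [← LinearMap.BilinForm.orthogonal_orthogonal sympBilin_nondegenerate sympBilin_isRefl (k ∙ w)]
  intro z hz
  have hz' : sympBilin w z = 0 := hz w (Submodule.mem_span_singleton_self w)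
  by_contra hne
  exact (fun h => hne (sympBilin_isRefl _ _ h)) (by
    by_contra h0
    exact hcon z h0 (sympBilin_isRefl _ _ hz'))

end SymplecticForm

section UnipotentIsometry

open Module

variable {F V : Type*} [Field F] [CharP F 2] [AddCommGroup V] [Module F V]

/-- In characteristic 2, the square of an isometry `T` with `(T - 1) ^ 3 = 0` defines an
alternating form `(v, w) ↦ b v (T (T w))` wherever `b` vanishes. -/
lemma isometry_sq_identities {b : LinearMap.BilinForm F V} (hb : b.IsAlt) {N : End F V}
    (hN : ∀ v w, b (v + N v) (w + N w) = b v w) (hN3 : ∀ v, N (N (N v)) = 0) :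
    (∀ v, b v (N (N v)) = 0) ∧ (∀ v w, b (N v) (N (N w)) = 0) ∧
      (∀ v w, b (N v) (N w) = b v (N (N w))) ∧ (∀ v w, b v (N w) = b w (N v) + b v (N (N w))) ∧
      ∀ v w, b v (N (N w)) = b w (N (N v)) := by
  have hsymm : ∀ v w, b v w = b w v := fun v w => by rw [← hb.neg_eq, CharTwo.neg_eq]
  have h2 : (2 : F) = 0 := CharTwo.two_eq_zero
  have h (v w) : b v (N w) + b (N v) w + b (N v) (N w) = 0 := by
    have := hN v w
    simp only [map_add, LinearMap.add_apply] at this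
    linear_combination this
  have h1 (v w) : b (N v) (N (N w)) = 0 := by
    simpa [hN3] using h v (N (N w))
  have h3 (v w) : b (N v) (N w) = b v (N (N w)) := by
    have := h v (N w)
    linear_combination this - h1 v w - b v (N (N w)) * h2
  have h4 (v) : b v (N (N v)) = 0 := by rw [← h3]; exact hb _
  refine ⟨h4, h1, h3, fun v w => ?_, fun v w => ?_⟩
  · have := h v w
    rw [hsymm (N v) w, h3] at this
    linear_combination this - (b w (N v) + b v (N (N w))) * h2
  · rw [← h3, hsymm, h3]

/-- Isotropic pairs on which the invariant takes prescribed values. -/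
lemma exists_isotropic_pair {b : LinearMap.BilinForm F V} (hb : b.IsAlt) {N : End F V}
    (hN : ∀ v w, b (v + N v) (w + N w) = b v w) (hN3 : ∀ v, N (N (N v)) = 0)
    {x y : V} (hxy : b x (N (N y)) ≠ 0) {S : Set V}
    (hS : ∀ a ∈ S, ∀ z, b a z ≠ 0 → ∃ t : F, z + t • a ∈ S) (hNS : ∀ v, N (N v) ∈ S) :
    ∃ C : F, ∀ l : F, ∃ w₁ ∈ S, ∃ w₂ ∈ S, b w₁ w₂ = 0 ∧ b w₁ (N (N w₂)) = 1 ∧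
      b w₁ (N w₁) * b w₂ (N w₂) + b w₁ (N w₂) * b w₂ (N w₁) = C + l * (l + 1) := by
  have hsymm : ∀ v w, b v w = b w v := fun v w => by rw [← hb.neg_eq, CharTwo.neg_eq]
  have h2 : (2 : F) = 0 := CharTwo.two_eq_zero
  obtain ⟨h4, h1, h3, h5, h6⟩ := isometry_sq_identities hb hN hN3
  obtain ⟨x, hxy⟩ : ∃ x, b x (N (N y)) = 1 :=
    ⟨(b x (N (N y)))⁻¹ • x, by simp [hxy]⟩
  refine ⟨b x (N x) * b y (N y), fun l => ?_⟩
  have h1' (v w) : b (N (N w)) (N v) = 0 := by rw [hsymm, h1]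
  have h4' (v) : b (N (N v)) v = 0 := by rw [hsymm, h4]
  have hyx : b y (N (N x)) = 1 := by rw [h6, hxy]
  have hxy' : b (N (N x)) y = 1 := by rw [hsymm, hyx]
  have hyx' : b (N (N y)) x = 1 := by rw [hsymm, hxy]
  set c := b x (N y) with hc
  set μ := b x y + (l + c) * b (N x) y with hμ
  obtain ⟨ν, hν⟩ := hS _ (hNS y) (x + (l + c) • N x + μ • N (N x)) (by
    simp [hyx', h1'])
  obtain ⟨κ, hκ⟩ := hS _ (hNS x) y (by simp [hxy'])
  have hyNx : b y (N x) = c + 1 := by rw [h5 y x, hyx]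
  refine ⟨_, hν, _, hκ, ?_, ?_, ?_⟩
  · simp only [map_add, map_smul, LinearMap.add_apply, LinearMap.smul_apply, smul_eq_mul, h4, h1,
      h4', hxy']
    linear_combination (b x y + (l + c) * b (N x) y) * h2
  · simp [hN3, h1, hxy]
  · simp only [map_add, map_smul, LinearMap.add_apply, LinearMap.smul_apply, smul_eq_mul, h4, h1,
      h1', h3, hN3, map_zero, hxy, hyx, hyNx, ← hc]
    linear_combination (2 * c * l + 2 * c * c + c) * h2

end UnipotentIsometry

section Transitivity

variable {k n}

/-- A group of isometries of `sympForm` preserving a set `S` of vectors, containing the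
transvections that exchange pairs of non-orthogonal vectors of `S`. -/
structure HasExchangeTransvections (Γ : Subgroup (GL (Fin n ⊕ Fin n) k))
    (S : Set ((Fin n ⊕ Fin n) → k)) : Prop where
  le_SpGroup : Γ ≤ SpGroup k n
  mulVec_mem : ∀ γ ∈ Γ, ∀ v ∈ S, γ.1 *ᵥ v ∈ S
  exists_translate : ∀ a ∈ S, ∀ z, sympBilin a z ≠ 0 → ∃ t : k, z + t • a ∈ S
  exists_exchange : ∀ a ∈ S, ∀ c ∈ S, sympBilin a c ≠ 0 →
    ∃ γ ∈ Γ, γ.1 *ᵥ a = c ∧ ∀ v, sympBilin v (a + c) = 0 → γ.1 *ᵥ v = v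

variable [CharP k 2] {Γ : Subgroup (GL (Fin n ⊕ Fin n) k)} {S : Set ((Fin n ⊕ Fin n) → k)}

lemma HasExchangeTransvections.exists_move (h : HasExchangeTransvections Γ S)
    {a c w : (Fin n ⊕ Fin n) → k} (ha : a ∈ S) (hc : c ∈ S) (haw : sympBilin a w = 0)
    (hcw : sympBilin c w = 0) (ha' : a ∉ k ∙ w) (hc' : c ∉ k ∙ w) :
    ∃ γ ∈ Γ, γ.1 *ᵥ a = c ∧ γ.1 *ᵥ w = w := by
  have hexch : ∀ a ∈ S, ∀ c ∈ S, sympBilin a w = 0 → sympBilin c w = 0 → sympBilin a c ≠ 0 →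
      ∃ γ ∈ Γ, γ.1 *ᵥ a = c ∧ γ.1 *ᵥ w = w := by
    intro a ha c hc haw hcw hac
    obtain ⟨γ, hγ, h1, h2⟩ := h.exists_exchange a ha c hc hac
    refine ⟨γ, hγ, h1, h2 w ?_⟩
    rw [sympBilin_comm, map_add, LinearMap.add_apply, haw, hcw, add_zero]
  by_cases hac : sympBilin a c = 0
  · obtain ⟨z, haz, hcz, hzw⟩ : ∃ z, sympBilin a z ≠ 0 ∧ sympBilin c z ≠ 0 ∧ sympBilin z w = 0 := by
      obtain ⟨z₁, h1, h1w⟩ := exists_sympBilin_ne_zero ha'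
      obtain ⟨z₂, h2, h2w⟩ := exists_sympBilin_ne_zero hc'
      by_cases h3 : sympBilin c z₁ = 0
      · by_cases h4 : sympBilin a z₂ = 0
        · exact ⟨z₁ + z₂, by simpa [h4], by simpa [h3], by simp [h1w, h2w]⟩
        · exact ⟨z₂, h4, h2, h2w⟩
      · exact ⟨z₁, h1, h3, h1w⟩
    obtain ⟨t, ht⟩ := h.exists_translate a ha z haz
    have hz1 : sympBilin a (z + t • a) ≠ 0 := by simpa [sympBilin_isAlt a] using haz
    have hz2 : sympBilin (z + t • a) c ≠ 0 := by
      rw [sympBilin_comm]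
      simpa [sympBilin_comm c a, hac] using hcz
    have hz3 : sympBilin (z + t • a) w = 0 := by simp [hzw, haw]
    obtain ⟨γ, hγ, h1, h2⟩ := hexch _ ha _ ht haw hz3 hz1
    obtain ⟨γ', hγ', h1', h2'⟩ := hexch _ ht _ hc hz3 hcw hz2
    refine ⟨γ' * γ, mul_mem hγ' hγ, ?_, ?_⟩
    · rw [Units.val_mul, ← Matrix.mulVec_mulVec, h1, h1']
    · rw [Units.val_mul, ← Matrix.mulVec_mulVec, h2, h2']
  · exact hexch a ha c hc haw hcw hac

lemma HasExchangeTransvections.exists_move_pair (h : HasExchangeTransvections Γ S)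
    {v₁ v₂ w₁ w₂ : (Fin n ⊕ Fin n) → k} (hv₁ : v₁ ∈ S) (hv₂ : v₂ ∈ S) (hw₁ : w₁ ∈ S) (hw₂ : w₂ ∈ S)
    (hv : sympBilin v₁ v₂ = 0) (hw : sympBilin w₁ w₂ = 0) (hvi : LinearIndependent k ![v₁, v₂])
    (hwi : LinearIndependent k ![w₁, w₂]) :
    ∃ γ ∈ Γ, γ.1 *ᵥ v₁ = w₁ ∧ γ.1 *ᵥ v₂ = w₂ := by
  have hpair : ∀ {v w : (Fin n ⊕ Fin n) → k}, LinearIndependent k ![v, w] →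
      v ≠ 0 ∧ w ∉ k ∙ v := by
    intro v w hvw
    have hv0 : v ≠ 0 := hvw.ne_zero 0
    refine ⟨hv0, fun hmem => ?_⟩
    obtain ⟨c, hc⟩ := Submodule.mem_span_singleton.1 hmem
    exact (LinearIndependent.pair_iff' hv0).1 hvw c hc
  obtain ⟨hv0, hvs⟩ := hpair hvi
  obtain ⟨hw0, hws⟩ := hpair hwi
  obtain ⟨γ, hγ, h1, -⟩ := h.exists_move (w := 0) hv₁ hw₁ (map_zero _) (map_zero _)
    (by simpa using hv0) (by simpa using hw0)
  have hisom := mem_SpGroup_iff.1 (h.le_SpGroup hγ)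
  obtain ⟨γ', hγ', h2, h3⟩ := h.exists_move (w := w₁) (h.mulVec_mem γ hγ v₂ hv₂) hw₂
    (by rw [← h1, hisom, sympBilin_comm, hv]) (by rw [sympBilin_comm, hw])
    (fun hmem => hvs (by
      obtain ⟨c, hc⟩ := Submodule.mem_span_singleton.1 hmem
      refine Submodule.mem_span_singleton.2 ⟨c, ?_⟩
      rw [← h1, ← Matrix.mulVec_smul] at hc
      exact Matrix.mulVec_injective_iff_isUnit.2 γ.isUnit hc)) hws
  exact ⟨γ' * γ, mul_mem hγ' hγ, by rw [Units.val_mul, ← Matrix.mulVec_mulVec, h1, h3],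
    by rw [Units.val_mul, ← Matrix.mulVec_mulVec, h2]⟩

end Transitivity

section SemiInvariants

open Module

variable {k n}

lemma eq_zero_of_mem_closure_conjOrbit {m K : Type*} [DecidableEq m] [Fintype m] [Field K]
    {G : Subgroup (GL m K)} {B : Subgroup G} {x : G} {f : GL m K → K} (hf : f ∈ regularFun m K)
    (h : ∀ b ∈ B, f (b * x * b⁻¹ : G) = 0) {y : G} (hy : y ∈ closure (conjOrbit B x)) :
    f y = 0 := by
  have hclosed : IsClosed {g : G | f g = 0} :=
    (isClosed_regularFun_zeros hf).preimage continuous_subtype_val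
  refine closure_minimal ?_ hclosed hy
  rintro _ ⟨b, hb, rfl⟩
  exact h b hb

lemma sympBilin_mulVec_left {g : GL (Fin n ⊕ Fin n) k} (hg : g ∈ SpGroup k n)
    (v w : (Fin n ⊕ Fin n) → k) : sympBilin v (g.1 *ᵥ w) = sympBilin (g⁻¹.1 *ᵥ v) w := by
  conv_lhs => rw [← glInvVec g v]
  exact mem_SpGroup_iff.1 hg _ _

lemma sympBilin_conj {h : GL (Fin n ⊕ Fin n) k} (hh : h ∈ SpGroup k n)
    (g : GL (Fin n ⊕ Fin n) k) (v w : (Fin n ⊕ Fin n) → k) :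
    sympBilin v ((h * g * h⁻¹).1 *ᵥ w) = sympBilin (h⁻¹.1 *ᵥ v) (g.1 *ᵥ (h⁻¹.1 *ᵥ w)) := by
  rw [← sympBilin_mulVec_left hh, Units.val_mul, Units.val_mul, Matrix.mulVec_mulVec,
    Matrix.mulVec_mulVec, Matrix.mul_assoc]

/-- The determinant of the matrix of `(v, w) ↦ sympForm v (g w)` on a pair of vectors. -/
def planeDet (v₁ v₂ : (Fin n ⊕ Fin n) → k) (g : GL (Fin n ⊕ Fin n) k) : k :=
  sympBilin v₁ (g.1 *ᵥ v₁) * sympBilin v₂ (g.1 *ᵥ v₂) +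
    sympBilin v₁ (g.1 *ᵥ v₂) * sympBilin v₂ (g.1 *ᵥ v₁)

/-- The value of `(v, w) ↦ sympForm v (g ^ 2 w)` on a pair of vectors. -/
def planeSq (v₁ v₂ : (Fin n ⊕ Fin n) → k) (g : GL (Fin n ⊕ Fin n) k) : k :=
  sympBilin v₁ ((g * g).1 *ᵥ v₂)

lemma planeDet_mem_regularFun (v₁ v₂ : (Fin n ⊕ Fin n) → k) :
    planeDet v₁ v₂ ∈ regularFun (Fin n ⊕ Fin n) k :=
  add_mem (mul_mem (regularFun_mulVec (sympBilin v₁) v₁) (regularFun_mulVec (sympBilin v₂) v₂))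
    (mul_mem (regularFun_mulVec (sympBilin v₁) v₂) (regularFun_mulVec (sympBilin v₂) v₁))

lemma planeSq_mem_regularFun (v₁ v₂ : (Fin n ⊕ Fin n) → k) :
    planeSq v₁ v₂ ∈ regularFun (Fin n ⊕ Fin n) k :=
  (IsRegularMap.id.mul IsRegularMap.id).comp_mem (regularFun_mulVec (sympBilin v₁) v₂)

lemma planeDet_conj {h : GL (Fin n ⊕ Fin n) k} (hh : h ∈ SpGroup k n)
    (g : GL (Fin n ⊕ Fin n) k) (v₁ v₂ : (Fin n ⊕ Fin n) → k) :
    planeDet v₁ v₂ (h * g * h⁻¹) = planeDet (h⁻¹.1 *ᵥ v₁) (h⁻¹.1 *ᵥ v₂) g := by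
  simp only [planeDet, sympBilin_conj hh]

lemma planeSq_conj {h : GL (Fin n ⊕ Fin n) k} (hh : h ∈ SpGroup k n)
    (g : GL (Fin n ⊕ Fin n) k) (v₁ v₂ : (Fin n ⊕ Fin n) → k) :
    planeSq v₁ v₂ (h * g * h⁻¹) = planeSq (h⁻¹.1 *ᵥ v₁) (h⁻¹.1 *ᵥ v₂) g := by
  have : h * g * h⁻¹ * (h * g * h⁻¹) = h * (g * g) * h⁻¹ := by group
  simp only [planeSq, this, sympBilin_conj hh]

lemma planeDet_comb [CharP k 2] (g : GL (Fin n ⊕ Fin n) k) (v₁ v₂ : (Fin n ⊕ Fin n) → k)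
    (α β γ δ : k) :
    planeDet (α • v₁ + β • v₂) (γ • v₁ + δ • v₂) g =
      (α * δ + β * γ) ^ 2 * planeDet v₁ v₂ g := by
  have h2 : (2 : k) = 0 := CharTwo.two_eq_zero
  simp only [planeDet, map_add, map_smul, LinearMap.add_apply, LinearMap.smul_apply, smul_eq_mul,
    Matrix.mulVec_add, Matrix.mulVec_smul]
  generalize sympBilin v₁ (g.1 *ᵥ v₁) = a
  generalize sympBilin v₁ (g.1 *ᵥ v₂) = b
  generalize sympBilin v₂ (g.1 *ᵥ v₁) = c
  generalize sympBilin v₂ (g.1 *ᵥ v₂) = d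
  linear_combination (α * a * β * c * γ ^ 2 + α * a * β * b * γ ^ 2 + α * β * c * d * δ ^ 2 +
    α * β * c ^ 2 * γ * δ + α * β * b * d * δ ^ 2 + α * β * b ^ 2 * γ * δ + α ^ 2 * a * c * γ * δ +
    α ^ 2 * a * b * γ * δ + α ^ 2 * a ^ 2 * γ ^ 2 + β ^ 2 * c * d * γ * δ +
    β ^ 2 * b * d * γ * δ + β ^ 2 * d ^ 2 * δ ^ 2) * h2

/-- The nilpotent part of a unipotent element. -/
def nilPart (g : GL (Fin n ⊕ Fin n) k) : End k ((Fin n ⊕ Fin n) → k) :=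
  Matrix.toLin' (g.1 - 1)

lemma add_nilPart (g : GL (Fin n ⊕ Fin n) k) (v : (Fin n ⊕ Fin n) → k) :
    v + nilPart g v = g.1 *ᵥ v := by
  simp [nilPart]

lemma nilPart_isometry {g : GL (Fin n ⊕ Fin n) k} (hg : g ∈ SpGroup k n)
    (v w : (Fin n ⊕ Fin n) → k) :
    sympBilin (v + nilPart g v) (w + nilPart g w) = sympBilin v w := by
  rw [add_nilPart, add_nilPart]
  exact mem_SpGroup_iff.1 hg v w

lemma nilPart_cube {g : GL (Fin n ⊕ Fin n) k}
    (hg : (g.1 - 1) ^ 3 = 0) (v : (Fin n ⊕ Fin n) → k) :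
    nilPart g (nilPart g (nilPart g v)) = 0 := by
  simp only [nilPart, Matrix.toLin'_apply, Matrix.mulVec_mulVec]
  rw [← mul_assoc, ← pow_three', hg, Matrix.zero_mulVec]

lemma mulVec_sq_eq [CharP k 2] (g : GL (Fin n ⊕ Fin n) k) (v : (Fin n ⊕ Fin n) → k) :
    (g * g).1 *ᵥ v = v + nilPart g (nilPart g v) := by
  have h2 : (2 : k) = 0 := CharTwo.two_eq_zero
  rw [Units.val_mul, ← Matrix.mulVec_mulVec, ← add_nilPart, ← add_nilPart, map_add]
  have : nilPart g v + nilPart g v = 0 := by rw [← two_smul k, h2, zero_smul]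
  rw [add_assoc, ← add_assoc (nilPart g v), this, zero_add]

lemma planeSq_eq [CharP k 2] (g : GL (Fin n ⊕ Fin n) k) (v w : (Fin n ⊕ Fin n) → k) :
    planeSq v w g = sympBilin v w + sympBilin v (nilPart g (nilPart g w)) := by
  rw [planeSq, mulVec_sq_eq, map_add]

lemma planeSq_comb [CharP k 2] {g : GL (Fin n ⊕ Fin n) k} (hg : g ∈ SpGroup k n)
    (hg3 : (g.1 - 1) ^ 3 = 0)
    (v₁ v₂ : (Fin n ⊕ Fin n) → k) (α β γ δ : k) :
    planeSq (α • v₁ + β • v₂) (γ • v₁ + δ • v₂) g = (α * δ + β * γ) * planeSq v₁ v₂ g := by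
  obtain ⟨h4, -, -, -, h6⟩ := isometry_sq_identities sympBilin_isAlt
    (nilPart_isometry hg) (nilPart_cube hg3)
  simp only [planeSq_eq, map_add, map_smul, LinearMap.add_apply, LinearMap.smul_apply, smul_eq_mul,
    h4, sympBilin_isAlt _, sympBilin_comm v₂ v₁, h6 v₂ v₁]
  ring

lemma not_subset_closure_conjOrbit [CharP k 2] [Infinite k] {G : Subgroup (GL (Fin n ⊕ Fin n) k)}
    (hG : G ≤ SpGroup k n) {S : Set ((Fin n ⊕ Fin n) → k)}
    (hS : ∀ a ∈ S, ∀ z, sympBilin a z ≠ 0 → ∃ t : k, z + t • a ∈ S)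
    (hpair : ∀ v₁ ∈ S, ∀ v₂ ∈ S, ∀ w₁ ∈ S, ∀ w₂ ∈ S, sympBilin v₁ v₂ = 0 → sympBilin w₁ w₂ = 0 →
      LinearIndependent k ![v₁, v₂] → LinearIndependent k ![w₁, w₂] →
      ∃ g ∈ G, g.1 *ᵥ w₁ = v₁ ∧ g.1 *ᵥ w₂ = v₂)
    {u : G} (hu3 : (u.1.1 - 1) ^ 3 = 0) (hu2 : (u.1.1 - 1) ^ 2 ≠ 0)
    (huS : ∀ v, nilPart u.1 (nilPart u.1 v) ∈ S)
    {B : Subgroup G} {W : Submodule k ((Fin n ⊕ Fin n) → k)}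
    (hW : IsStableSubspace (B.map G.subtype) W) (hW2 : finrank k W = 2) (hWS : ∀ v ∈ W, v ∈ S)
    (hWiso : ∀ v ∈ W, ∀ w ∈ W, sympBilin v w = 0) {x : G} (hx : x ∈ conjClass u) :
    ¬ conjClass u ⊆ closure (conjOrbit B x) := by
  intro hcl
  obtain ⟨h, hh⟩ := isConj_iff.1 hx
  have hx3 : (x.1.1 - 1) ^ 3 = 0 := by
    have : x.1.1 - 1 = h.1.1 * (u.1.1 - 1) * h.1⁻¹.1 := by
      rw [← hh]
      simp only [Subgroup.coe_mul, Subgroup.coe_inv, Units.val_mul, mul_sub, sub_mul, mul_one,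
        Units.mul_inv]
    rw [this]
    have hc := Units.conj_pow h.1 (u.1.1 - 1) 3
    rw [hc, hu3, mul_zero, zero_mul]
  let e := finBasisOfFinrankEq k W hW2
  let v₁ : (Fin n ⊕ Fin n) → k := (e 0 : W)
  let v₂ : (Fin n ⊕ Fin n) → k := (e 1 : W)
  have hv₁ : v₁ ∈ W := (e 0).2
  have hv₂ : v₂ ∈ W := (e 1).2
  have hvi : LinearIndependent k ![v₁, v₂] := by
    have hfun : ![v₁, v₂] = W.subtype ∘ e := by
      funext i
      fin_cases i <;> rfl
    rw [hfun]
    exact e.linearIndependent.map' W.subtype W.ker_subtype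
  have hcomb (w) (hw : w ∈ W) : ∃ α β : k, w = α • v₁ + β • v₂ := by
    refine ⟨e.repr ⟨w, hw⟩ 0, e.repr ⟨w, hw⟩ 1, ?_⟩
    have := congrArg Subtype.val (e.sum_repr ⟨w, hw⟩)
    rw [Fin.sum_univ_two] at this
    exact this.symm
  have hsemi (b) (hb : b ∈ B) : ∃ d : k,
      planeDet v₁ v₂ (b * x * b⁻¹ : G) = d ^ 2 * planeDet v₁ v₂ x ∧
      planeSq v₁ v₂ (b * x * b⁻¹ : G) = d * planeSq v₁ v₂ x := by
    have hbinv : (b.1)⁻¹ ∈ B.map G.subtype := ⟨b⁻¹, inv_mem hb, rfl⟩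
    obtain ⟨α, β, hα⟩ := hcomb _ (hW _ hbinv v₁ hv₁)
    obtain ⟨γ, δ, hγ⟩ := hcomb _ (hW _ hbinv v₂ hv₂)
    refine ⟨α * δ + β * γ, ?_, ?_⟩
    · rw [Subgroup.coe_mul, Subgroup.coe_mul, Subgroup.coe_inv, planeDet_conj (hG b.2), hα, hγ,
        planeDet_comb]
    · rw [Subgroup.coe_mul, Subgroup.coe_mul, Subgroup.coe_inv, planeSq_conj (hG b.2), hα, hγ,
        planeSq_comb (hG x.2) hx3]
  have hvan1 : ∀ y ∈ conjClass u, planeDet v₁ v₂ y * planeSq v₁ v₂ x ^ 2 -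
      planeDet v₁ v₂ x * planeSq v₁ v₂ y ^ 2 = 0 := fun y hy => by
    refine eq_zero_of_mem_closure_conjOrbit (B := B) (x := x)
      (f := fun g => planeDet v₁ v₂ g * planeSq v₁ v₂ x ^ 2 -
        planeDet v₁ v₂ x * planeSq v₁ v₂ g ^ 2)
      (sub_mem (mul_mem (planeDet_mem_regularFun v₁ v₂) (regularFun_const _))
        (mul_mem (regularFun_const _) (pow_mem (planeSq_mem_regularFun v₁ v₂) 2)))
      (fun b hb => ?_) (hcl hy)
    obtain ⟨d, h1, h2⟩ := hsemi b hb
    simp only [h1, h2]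
    ring
  obtain ⟨p, q, hpq⟩ : ∃ p q, sympBilin p (nilPart u.1 (nilPart u.1 q)) ≠ 0 := by
    by_contra! hcon
    refine hu2 (Matrix.toLin'.injective (LinearMap.ext fun q => ?_))
    rw [map_zero, LinearMap.zero_apply, pow_two, Matrix.toLin'_mul]
    exact sympBilin_nondegenerate.2 _ fun p => hcon p q
  have hN := nilPart_isometry (hG u.2)
  have hN3 := nilPart_cube hu3
  obtain ⟨C, hC⟩ := exists_isotropic_pair sympBilin_isAlt hN hN3 hpq hS huS
  have hval (l : k) : ∃ y ∈ conjClass u,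
      planeDet v₁ v₂ y = C + l * (l + 1) ∧ planeSq v₁ v₂ y = 1 := by
    obtain ⟨w₁, hw₁, w₂, hw₂, hw, h1, hdet⟩ := hC l
    have h4 := (isometry_sq_identities sympBilin_isAlt hN hN3).1
    have hwi : LinearIndependent k ![w₁, w₂] := by
      refine (LinearIndependent.pair_iff' ?_).2 ?_
      · rintro rfl
        simp at h1
      · rintro c rfl
        simp [h4] at h1
    obtain ⟨g, hg, hg1, hg2⟩ := hpair v₁ (hWS _ hv₁) v₂ (hWS _ hv₂) w₁ hw₁ w₂ hw₂
      (hWiso _ hv₁ _ hv₂) hw hvi hwi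
    have hginv (w v : (Fin n ⊕ Fin n) → k) (hwv : g.1 *ᵥ w = v) : g⁻¹.1 *ᵥ v = w := by
      have := glInvVec g⁻¹ w
      rwa [inv_inv, hwv] at this
    refine ⟨⟨g, hg⟩ * u * ⟨g, hg⟩⁻¹, isConj_iff.2 ⟨_, rfl⟩, ?_, ?_⟩
    · rw [Subgroup.coe_mul, Subgroup.coe_mul, Subgroup.coe_inv, planeDet_conj (hG hg),
        hginv _ _ hg1, hginv _ _ hg2, ← hdet]
      simp only [planeDet, ← add_nilPart, map_add, sympBilin_isAlt _, hw, sympBilin_comm w₂ w₁,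
        zero_add]
    · rw [Subgroup.coe_mul, Subgroup.coe_mul, Subgroup.coe_inv, planeSq_conj (hG hg),
        hginv _ _ hg1, hginv _ _ hg2, planeSq_eq, hw, h1, zero_add]
  have hsq0 : planeSq v₁ v₂ x = 0 := by
    obtain ⟨l, hl⟩ := (Set.toFinite ({0, -1} : Set k)).exists_notMem
    obtain ⟨y, hy, hy1, hy2⟩ := hval 0
    obtain ⟨z, hz, hz1, hz2⟩ := hval l
    have ey := hvan1 y hy
    have ez := hvan1 z hz
    rw [hy1, hy2] at ey
    rw [hz1, hz2] at ez
    have hprod : l * (l + 1) * planeSq v₁ v₂ x ^ 2 = 0 := by linear_combination ez - ey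
    simp only [Set.mem_insert_iff, Set.mem_singleton_iff, not_or] at hl
    have hl1 : l + 1 ≠ 0 := fun h => hl.2 (eq_neg_of_add_eq_zero_left h)
    simpa [hl.1, hl1] using hprod
  obtain ⟨y, hy, -, hy2⟩ := hval 0
  have := eq_zero_of_mem_closure_conjOrbit (B := B) (x := x) (planeSq_mem_regularFun v₁ v₂)
    (fun b hb => by
      obtain ⟨d, -, h2⟩ := hsemi b hb
      rw [h2, hsq0, mul_zero]) (hcl hy)
  rw [hy2] at this
  exact one_ne_zero this

end SemiInvariants

section StablePlanes

open Module

universe v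

variable {k : Type v} [Field k] {n : ℕ}

lemma IsBorel.hasCommonEigenvectors.{w} {m K : Type*} [DecidableEq m] [Fintype m] [Field K]
    [IsAlgClosed K] {G : Subgroup (GL m K)} {B : Subgroup G} (hB : IsBorel G B) :
    HasCommonEigenvectors.{_, _, w} (B.map G.subtype) := by
  have hsol : Group.IsSolvable B := hB.2.2.1
  have : Group.IsSolvable (B.map G.subtype) :=
    Group.isSolvable_of_surjective (G.subtype.subgroupMap_surjective B)
  refine hasCommonEigenvectors_of_isSolvable _ ?_
  rw [Subgroup.coe_map]
  exact hB.2.1.isPreconnected.image _ continuous_subtype_val.continuousOn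

/-- A subspace on which `sympForm` vanishes. -/
def IsIsotropicSubspace (X : Submodule k ((Fin n ⊕ Fin n) → k)) : Prop :=
  ∀ v ∈ X, ∀ w ∈ X, sympBilin v w = 0

lemma IsStableSubspace.orthogonal {Γ : Subgroup (GL (Fin n ⊕ Fin n) k)} (hΓ : Γ ≤ SpGroup k n)
    {X : Submodule k ((Fin n ⊕ Fin n) → k)} (hX : IsStableSubspace Γ X) :
    IsStableSubspace Γ (sympBilin.orthogonal X) := by
  intro g hg v hv x hx
  rw [sympBilin_mulVec_left (hΓ hg)]
  exact hv _ (hX _ (inv_mem hg) x hx)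

lemma IsIsotropicSubspace.exists_stable_extension [CharP k 2]
    {Γ : Subgroup (GL (Fin n ⊕ Fin n) k)} (hΓ : Γ ≤ SpGroup k n)
    (hev : HasCommonEigenvectors.{_, _, v} Γ) {X : Submodule k ((Fin n ⊕ Fin n) → k)}
    (hXiso : IsIsotropicSubspace X) (hX : IsStableSubspace Γ X) (hlt : finrank k X < n) :
    ∃ X' : Submodule k ((Fin n ⊕ Fin n) → k), IsIsotropicSubspace X' ∧ IsStableSubspace Γ X' ∧
      finrank k X' = finrank k X + 1 := by
  have hle : X ≤ sympBilin.orthogonal X := fun v hv w hw => hXiso w hw v hv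
  have hlt' : X < sympBilin.orthogonal X := by
    refine lt_of_le_of_ne hle fun h => ?_
    have := finrank_orthogonal_sympBilin X
    rw [← h] at this
    omega
  obtain ⟨v, hv, hst, hfin⟩ := hev.exists_stable_extension hX (hX.orthogonal hΓ) hlt'
  refine ⟨_, ?_, hst, hfin⟩
  have hv' : ∀ x ∈ X, sympBilin x v = 0 := hv
  intro a ha b hb
  obtain ⟨x, hx, y, hy, rfl⟩ := Submodule.mem_sup.1 ha
  obtain ⟨x', hx', y', hy', rfl⟩ := Submodule.mem_sup.1 hb
  obtain ⟨c, rfl⟩ := Submodule.mem_span_singleton.1 hy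
  obtain ⟨c', rfl⟩ := Submodule.mem_span_singleton.1 hy'
  simp [hXiso x hx x' hx', hv' x hx, sympBilin_comm v x', hv' x' hx', sympBilin_isAlt v]

lemma exists_isotropic_stable [CharP k 2] {Γ : Subgroup (GL (Fin n ⊕ Fin n) k)}
    (hΓ : Γ ≤ SpGroup k n) (hev : HasCommonEigenvectors.{_, _, v} Γ) {d : ℕ} (hd : d ≤ n) :
    ∃ X : Submodule k ((Fin n ⊕ Fin n) → k), IsIsotropicSubspace X ∧ IsStableSubspace Γ X ∧
      finrank k X = d := by
  induction d with
  | zero =>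
    refine ⟨⊥, fun v hv w _ => ?_, isStableSubspace_bot Γ, finrank_bot k _⟩
    rw [(Submodule.mem_bot k).1 hv, map_zero, LinearMap.zero_apply]
  | succ d ih =>
    obtain ⟨X, hXiso, hX, rfl⟩ := ih (by omega)
    exact hXiso.exists_stable_extension hΓ hev hX (by omega)

/-- The vectors of an isotropic subspace on which `quadForm` vanishes. -/
def singularPart [CharP k 2] (U : Submodule k ((Fin n ⊕ Fin n) → k))
    (hU : IsIsotropicSubspace U) : Submodule k ((Fin n ⊕ Fin n) → k) where
  carrier := {v | v ∈ U ∧ quadForm k n v = 0}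
  add_mem' := fun {v w} hv hw =>
    ⟨add_mem hv.1 hw.1, by rw [quadForm_add, hv.2, hw.2, hU v hv.1 w hw.1]; simp⟩
  zero_mem' := ⟨zero_mem U, by simp [quadForm]⟩
  smul_mem' := fun c v hv =>
    ⟨U.smul_mem c hv.1, by rw [quadForm_smul, hv.2, mul_zero]⟩

lemma finrank_le_singularPart [CharP k 2] [IsAlgClosed k]
    (U : Submodule k ((Fin n ⊕ Fin n) → k)) (hU : IsIsotropicSubspace U) :
    finrank k U ≤ finrank k (singularPart U hU) + 1 := by
  by_cases h : ∃ v ∈ U, quadForm k n v ≠ 0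
  · obtain ⟨v, hv, hQ⟩ := h
    have hle : U ≤ singularPart U hU ⊔ k ∙ v := by
      intro w hw
      obtain ⟨c, hc⟩ := IsAlgClosed.exists_pow_nat_eq (quadForm k n w / quadForm k n v) two_pos
      have hmem : w + c • v ∈ singularPart U hU := by
        refine ⟨add_mem hw (U.smul_mem c hv), ?_⟩
        rw [quadForm_add, quadForm_smul, hc, div_mul_cancel₀ _ hQ, map_smul, hU w hw v hv,
          CharTwo.add_self_eq_zero, smul_zero, add_zero]
      have hsub : w = (w + c • v) + (-c) • v := by simp
      rw [hsub]
      exact Submodule.add_mem_sup hmem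
        (Submodule.smul_mem _ _ (Submodule.mem_span_singleton_self v))
    refine (Submodule.finrank_mono hle).trans
      ((Submodule.finrank_add_le_finrank_add_finrank _ _).trans ?_)
    gcongr
    exact (finrank_span_le_card {v}).trans (by simp)
  · push Not at h
    have hle : U ≤ singularPart U hU := fun v hv => ⟨hv, h v hv⟩
    exact (Submodule.finrank_mono hle).trans (Nat.le_succ _)

lemma exists_singular_stable_plane [CharP k 2] [IsAlgClosed k] (hn : 3 ≤ n)
    {Γ : Subgroup (GL (Fin n ⊕ Fin n) k)} (hΓ : Γ ≤ evenOrthGroup k n)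
    (hev : HasCommonEigenvectors.{_, _, v} Γ) :
    ∃ W : Submodule k ((Fin n ⊕ Fin n) → k), IsStableSubspace Γ W ∧ finrank k W = 2 ∧
      IsIsotropicSubspace W ∧ ∀ v ∈ W, quadForm k n v = 0 := by
  obtain ⟨U, hUiso, hU, hU3⟩ :=
    exists_isotropic_stable (hΓ.trans evenOrthGroup_le_SpGroup) hev hn
  have hY : IsStableSubspace Γ (singularPart U hUiso) := fun g hg v hv =>
    ⟨hU g hg v hv.1, by rw [mem_evenOrthGroup_iff.1 (hΓ hg)]; exact hv.2⟩
  have hY2 := finrank_le_singularPart U hUiso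
  rw [hU3] at hY2
  obtain ⟨v, hv, hst, hfin⟩ := hev.exists_stable_extension (isStableSubspace_bot Γ) hY
    (bot_lt_iff_ne_bot.2 fun h => by
      rw [h, finrank_bot] at hY2
      omega)
  rw [finrank_bot] at hfin
  have hle : ⊥ ⊔ k ∙ v ≤ singularPart U hUiso :=
    sup_le bot_le ((Submodule.span_singleton_le_iff_mem _ _).2 hv)
  obtain ⟨w, hw, hst', hfin'⟩ := hev.exists_stable_extension hst hY
    (lt_of_le_of_ne hle fun h => by
      rw [← h, hfin] at hY2
      omega)
  have hle' : ⊥ ⊔ k ∙ v ⊔ k ∙ w ≤ singularPart U hUiso :=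
    sup_le hle ((Submodule.span_singleton_le_iff_mem _ _).2 hw)
  exact ⟨_, hst', by rw [hfin', hfin],
    fun a ha b hb => hUiso a (hle' ha).1 b (hle' hb).1, fun a ha => (hle' ha).2⟩

end StablePlanes

section Transvections

open Module

variable {k n} [CharP k 2]

/-- The linear map `v ↦ v + l * sympForm v c • c`. -/
def transvectionMap (c : (Fin n ⊕ Fin n) → k) (l : k) : End k ((Fin n ⊕ Fin n) → k) :=
  LinearMap.id + (l • sympBilin.flip c).smulRight c

omit [CharP k 2] in
lemma transvectionMap_apply (c : (Fin n ⊕ Fin n) → k) (l : k) (v : (Fin n ⊕ Fin n) → k) :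
    transvectionMap c l v = v + (l * sympBilin v c) • c := rfl

lemma transvectionMap_mul_self (c : (Fin n ⊕ Fin n) → k) (l : k) :
    transvectionMap c l * transvectionMap c l = 1 := by
  refine LinearMap.ext fun v => ?_
  have h : sympBilin (v + (l * sympBilin v c) • c) c = sympBilin v c := by
    simp [sympBilin_isAlt c]
  rw [End.mul_apply, transvectionMap_apply, transvectionMap_apply, h, add_assoc, ← add_smul,
    CharTwo.add_self_eq_zero, zero_smul, add_zero, End.one_apply]

/-- The symplectic transvection `v ↦ v + l * sympForm v c • c` in characteristic 2. -/
def sympTransvection (c : (Fin n ⊕ Fin n) → k) (l : k) : GL (Fin n ⊕ Fin n) k where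
  val := LinearMap.toMatrix' (transvectionMap c l)
  inv := LinearMap.toMatrix' (transvectionMap c l)
  val_inv := by
    rw [← LinearMap.toMatrix'_mul, transvectionMap_mul_self, LinearMap.toMatrix'_one]
  inv_val := by
    rw [← LinearMap.toMatrix'_mul, transvectionMap_mul_self, LinearMap.toMatrix'_one]

lemma sympTransvection_mulVec (c : (Fin n ⊕ Fin n) → k) (l : k) (v : (Fin n ⊕ Fin n) → k) :
    (sympTransvection c l).1 *ᵥ v = v + (l * sympBilin v c) • c :=
  LinearMap.toMatrix'_mulVec _ _

lemma sympTransvection_inv (c : (Fin n ⊕ Fin n) → k) (l : k) :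
    (sympTransvection c l)⁻¹ = sympTransvection c l :=
  Units.ext rfl

lemma sympTransvection_mul_self (c : (Fin n ⊕ Fin n) → k) (l : k) :
    sympTransvection c l * sympTransvection c l = 1 := by
  nth_rewrite 1 [← sympTransvection_inv c l]
  exact inv_mul_cancel _

lemma sympTransvection_mem_SpGroup (c : (Fin n ⊕ Fin n) → k) (l : k) :
    sympTransvection c l ∈ SpGroup k n := by
  refine mem_SpGroup_iff.2 fun v w => ?_
  have h2 : (2 : k) = 0 := CharTwo.two_eq_zero
  simp only [sympTransvection_mulVec, map_add, map_smul, LinearMap.add_apply, LinearMap.smul_apply,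
    smul_eq_mul, sympBilin_isAlt c, sympBilin_comm c w]
  linear_combination (l * sympBilin v c * sympBilin w c) * h2

lemma sympTransvection_mem_evenOrthGroup {c : (Fin n ⊕ Fin n) → k} {l : k}
    (h : l * quadForm k n c = 1) : sympTransvection c l ∈ evenOrthGroup k n := by
  refine mem_evenOrthGroup_iff.2 fun v => ?_
  have h2 : (2 : k) = 0 := CharTwo.two_eq_zero
  rw [sympTransvection_mulVec, quadForm_add, quadForm_smul, map_smul, smul_eq_mul]
  linear_combination l * sympBilin v c ^ 2 * h + l * sympBilin v c ^ 2 * h2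

lemma sympTransvection_exchange {a c : (Fin n ⊕ Fin n) → k} (hac : sympBilin a c ≠ 0) :
    (sympTransvection (a + c) (sympBilin a c)⁻¹).1 *ᵥ a = c := by
  rw [sympTransvection_mulVec, map_add, sympBilin_isAlt a, zero_add, inv_mul_cancel₀ hac, one_smul,
    ← add_assoc, ← two_smul k a, CharTwo.two_eq_zero, zero_smul, zero_add]

lemma sympTransvection_fix {c v : (Fin n ⊕ Fin n) → k} (l : k) (h : sympBilin v c = 0) :
    (sympTransvection c l).1 *ᵥ v = v := by
  rw [sympTransvection_mulVec, h, mul_zero, zero_smul, add_zero]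

lemma hasExchangeTransvections_SpGroup :
    HasExchangeTransvections (SpGroup k n) Set.univ where
  le_SpGroup := le_rfl
  mulVec_mem _ _ _ _ := trivial
  exists_translate _ _ _ _ := ⟨0, trivial⟩
  exists_exchange _ _ _ _ hac := ⟨_, sympTransvection_mem_SpGroup _ _,
    sympTransvection_exchange hac, fun _ => sympTransvection_fix _⟩

variable (k n) in
/-- The orthogonal transvections. -/
def orthTransvections : Set (GL (Fin n ⊕ Fin n) k) :=
  {g | ∃ c l, l * quadForm k n c = 1 ∧ g = sympTransvection c l}

lemma closure_orthTransvections_le :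
    Subgroup.closure (orthTransvections k n) ≤ evenOrthGroup k n := by
  rw [Subgroup.closure_le]
  rintro _ ⟨c, l, h, rfl⟩
  exact sympTransvection_mem_evenOrthGroup h

lemma exists_singular_translate {a z : (Fin n ⊕ Fin n) → k} (ha : quadForm k n a = 0)
    (haz : sympBilin a z ≠ 0) : ∃ t : k, quadForm k n (z + t • a) = 0 := by
  refine ⟨quadForm k n z / sympBilin a z, ?_⟩
  rw [quadForm_add, quadForm_smul, ha, mul_zero, add_zero, map_smul, smul_eq_mul,
    sympBilin_comm z a, div_mul_cancel₀ _ haz, CharTwo.add_self_eq_zero]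

lemma hasExchangeTransvections_orth :
    HasExchangeTransvections (Subgroup.closure (orthTransvections k n))
      {v | quadForm k n v = 0} where
  le_SpGroup := closure_orthTransvections_le.trans evenOrthGroup_le_SpGroup
  mulVec_mem γ hγ v hv := by
    rw [Set.mem_ofPred_eq, mem_evenOrthGroup_iff.1 (closure_orthTransvections_le hγ)]
    exact hv
  exists_translate _ ha _ haz := exists_singular_translate ha haz
  exists_exchange a ha c hc hac := by
    refine ⟨_, Subgroup.subset_closure ⟨a + c, _, ?_, rfl⟩,
      sympTransvection_exchange hac, fun _ => sympTransvection_fix _⟩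
    rw [Set.mem_ofPred_eq] at ha hc
    rw [quadForm_add, ha, hc, zero_add, zero_add, inv_mul_cancel₀ hac]

lemma mem_or_transvection_mul_mem {H : Subgroup (GL (Fin n ⊕ Fin n) k)}
    (hH : ∀ g ∈ orthTransvections k n, ∀ g' ∈ orthTransvections k n, g * g' ∈ H)
    {γ : GL (Fin n ⊕ Fin n) k} (hγ : γ ∈ Subgroup.closure (orthTransvections k n)) :
    γ ∈ H ∨ ∀ g ∈ orthTransvections k n, g * γ ∈ H := by
  have step : ∀ x ∈ orthTransvections k n, ∀ y,
      (y ∈ H ∨ ∀ g ∈ orthTransvections k n, g * y ∈ H) →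
      (x * y ∈ H ∨ ∀ g ∈ orthTransvections k n, g * (x * y) ∈ H) := by
    rintro x hx y (hy | hy)
    · exact Or.inr fun g hg => by rw [← mul_assoc]; exact mul_mem (hH g hg x hx) hy
    · exact Or.inl (hy x hx)
  induction hγ using Subgroup.closure_induction_left with
  | one => exact Or.inl (one_mem H)
  | mul_left x hx y _ ih => exact step x hx y ih
  | inv_mul_cancel x hx y _ ih =>
    obtain ⟨c, l, h, rfl⟩ := hx
    rw [sympTransvection_inv]
    exact step _ ⟨c, l, h, rfl⟩ y ih

lemma exists_quadForm_ne_zero_orthogonal (hn : 3 ≤ n) (v₁ v₂ : (Fin n ⊕ Fin n) → k) :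
    ∃ y, quadForm k n y ≠ 0 ∧ sympBilin v₁ y = 0 ∧ sympBilin v₂ y = 0 := by
  by_contra! hcon
  set X := Submodule.span k (Set.range ![v₁, v₂])
  have hX2 : finrank k X ≤ 2 := finrank_range_le_card ![v₁, v₂]
  have hQ : ∀ y ∈ sympBilin.orthogonal X, quadForm k n y = 0 := fun y hy => by
    by_contra h
    exact hcon y h (hy _ (Submodule.subset_span ⟨0, rfl⟩)) (hy _ (Submodule.subset_span ⟨1, rfl⟩))
  have hle : sympBilin.orthogonal X ≤ X := by
    conv_rhs => rw [← LinearMap.BilinForm.orthogonal_orthogonal sympBilin_nondegenerate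
      sympBilin_isRefl X]
    intro y hy z hz
    have := hQ _ (add_mem hz hy)
    rwa [quadForm_add, hQ z hz, hQ y hy, zero_add, zero_add] at this
  have h1 := Submodule.finrank_mono hle
  rw [finrank_orthogonal_sympBilin] at h1
  omega

lemma exists_move_pair_orth (hn : 3 ≤ n) {H : Subgroup (GL (Fin n ⊕ Fin n) k)}
    (hH : ∀ g ∈ orthTransvections k n, ∀ g' ∈ orthTransvections k n, g * g' ∈ H)
    {v₁ v₂ w₁ w₂ : (Fin n ⊕ Fin n) → k} (hv₁ : quadForm k n v₁ = 0) (hv₂ : quadForm k n v₂ = 0)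
    (hw₁ : quadForm k n w₁ = 0) (hw₂ : quadForm k n w₂ = 0)
    (hv : sympBilin v₁ v₂ = 0) (hw : sympBilin w₁ w₂ = 0) (hvi : LinearIndependent k ![v₁, v₂])
    (hwi : LinearIndependent k ![w₁, w₂]) :
    ∃ γ ∈ H, γ.1 *ᵥ v₁ = w₁ ∧ γ.1 *ᵥ v₂ = w₂ := by
  obtain ⟨γ, hγ, h1, h2⟩ :=
    hasExchangeTransvections_orth.exists_move_pair hv₁ hv₂ hw₁ hw₂ hv hw hvi hwi
  rcases mem_or_transvection_mul_mem hH hγ with h | h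
  · exact ⟨γ, h, h1, h2⟩
  · obtain ⟨y, hy, hy1, hy2⟩ := exists_quadForm_ne_zero_orthogonal hn w₁ w₂
    refine ⟨_, h _ ⟨y, _, inv_mul_cancel₀ hy, rfl⟩, ?_, ?_⟩
    · rw [Units.val_mul, ← Matrix.mulVec_mulVec, h1, sympTransvection_fix _ hy1]
    · rw [Units.val_mul, ← Matrix.mulVec_mulVec, h2, sympTransvection_fix _ hy2]

end Transvections

section Connectedness

open Polynomial

lemma continuous_of_rational {m K : Type*} [DecidableEq m] [Fintype m] [Field K] {q : K[X]}
    {φ : {t : K // q.eval t ≠ 0} → GL m K}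
    (h : ∀ i j, ∃ (P : K[X]) (N : ℕ), ∀ t, P.eval t.1 = q.eval t.1 ^ N * (φ t).1 i j)
    (hinv : ∀ i j, ∃ (P : K[X]) (N : ℕ), ∀ t, P.eval t.1 = q.eval t.1 ^ N * (φ t)⁻¹.1 i j) :
    Continuous (φ ∘ CofiniteTopology.of.symm) := by
  have hrat : ∀ f ∈ regularFun m K,
      ∃ (P : K[X]) (N : ℕ), ∀ t, P.eval t.1 = q.eval t.1 ^ N * f (φ t) := by
    intro f hf
    induction hf using Algebra.adjoin_induction with
    | mem f hf =>
      obtain ⟨p | p, rfl⟩ := hf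
      · exact h p.1 p.2
      · exact hinv p.1 p.2
    | algebraMap r => exact ⟨C r, 0, fun t => by simp⟩
    | add f g _ _ hf hg =>
      obtain ⟨P, N, hP⟩ := hf
      obtain ⟨Q, M, hQ⟩ := hg
      refine ⟨q ^ M * P + q ^ N * Q, N + M, fun t => ?_⟩
      simp only [eval_add, eval_mul, eval_pow, hP, hQ, Pi.add_apply]
      ring
    | mul f g _ _ hf hg =>
      obtain ⟨P, N, hP⟩ := hf
      obtain ⟨Q, M, hQ⟩ := hg
      refine ⟨P * Q, N + M, fun t => ?_⟩
      simp only [eval_mul, hP, hQ, Pi.mul_apply]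
      ring
  refine continuous_induced_rng.2 (continuous_generateFrom_iff.2 ?_)
  rintro _ ⟨p, rfl⟩
  obtain ⟨P, N, hP⟩ := hrat _ (mem_regularFun_iff.2 ⟨p, fun _ => rfl⟩)
  rw [CofiniteTopology.isOpen_iff]
  rintro ⟨s, hs⟩
  have hP0 : P ≠ 0 := by
    rintro rfl
    have := hP (CofiniteTopology.of.symm s)
    rw [eval_zero] at this
    exact (mul_ne_zero (pow_ne_zero N (CofiniteTopology.of.symm s).2) hs) this.symm
  have hfin : {t : {t : K // q.eval t ≠ 0} | P.IsRoot t.1}.Finite :=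
    (finite_setOfPred_isRoot hP0).preimage Subtype.val_injective.injOn
  refine (hfin.preimage CofiniteTopology.of.symm.injective.injOn).subset fun t ht => ?_
  have ht0 : MvPolynomial.eval (fun i => glCoord i (φ (CofiniteTopology.of.symm t))) p = 0 :=
    not_not.1 ht
  rw [Set.mem_preimage, Set.mem_ofPred_eq, IsRoot.def, hP, ht0, mul_zero]

variable {k n}

lemma transvection_mul_mem_evenSOGroup [CharP k 2] [Infinite k] :
    ∀ g ∈ orthTransvections k n, ∀ g' ∈ orthTransvections k n, g * g' ∈ evenSOGroup k n := by
  rintro _ ⟨c, l, hl, rfl⟩ _ ⟨c', l', hl', rfl⟩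
  set d := c + c' with hd
  let q : k[X] := C (quadForm k n c') + X ^ 2 * C (quadForm k n d) + X * C (sympBilin c' d)
  have hq (t : k) : q.eval t = quadForm k n (c' + t • d) := by
    simp only [q, quadForm_add, quadForm_smul, map_smul, smul_eq_mul, eval_add, eval_mul, eval_C,
      eval_pow, eval_X]
  have hsum : c' + (1 : k) • d = c := by
    rw [one_smul, hd, add_comm c, ← add_assoc, ← two_smul k c', CharTwo.two_eq_zero, zero_smul,
      zero_add]
  have hq0 : q.eval 0 ≠ 0 := by
    rw [hq, zero_smul, add_zero]
    exact right_ne_zero_of_mul_eq_one hl'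
  have hq1 : q.eval 1 ≠ 0 := by
    rw [hq, hsum]
    exact right_ne_zero_of_mul_eq_one hl
  have hqne : q ≠ 0 := fun h => hq0 (by rw [h, eval_zero])
  have : Infinite {t : k // q.eval t ≠ 0} :=
    (finite_setOfPred_isRoot hqne).infinite_compl.to_subtype
  let τ : {t : k // q.eval t ≠ 0} → GL (Fin n ⊕ Fin n) k :=
    fun t => sympTransvection (c' + t.1 • d) (q.eval t.1)⁻¹
  have hentry : ∀ i j, ∃ (P : k[X]) (N : ℕ), ∀ t, P.eval t.1 = q.eval t.1 ^ N * (τ t).1 i j := by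
    intro i j
    refine ⟨q * C ((1 : Matrix (Fin n ⊕ Fin n) (Fin n ⊕ Fin n) k) i j) +
      (C (sympBilin (Pi.single j 1) c') + X * C (sympBilin (Pi.single j 1) d)) *
        (C (c' i) + X * C (d i)), 1, fun t => ?_⟩
    have hcol : (τ t).1 i j = ((τ t).1 *ᵥ Pi.single j 1) i := by simp
    rw [hcol, sympTransvection_mulVec, pow_one, Pi.add_apply, mul_add]
    have hone : (Pi.single j 1 : (Fin n ⊕ Fin n) → k) i =
        (1 : Matrix (Fin n ⊕ Fin n) (Fin n ⊕ Fin n) k) i j := by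
      rw [Matrix.one_apply, Pi.single_apply]
    have ht := t.2
    simp only [hone, Pi.smul_apply, Pi.add_apply, smul_eq_mul, map_add, map_smul, eval_add,
      eval_mul, eval_C, eval_X]
    field_simp
  have hcont : Continuous (τ ∘ CofiniteTopology.of.symm) :=
    continuous_of_rational hentry (fun i j => by
      obtain ⟨P, N, hP⟩ := hentry i j
      exact ⟨P, N, fun t => by rw [hP]; simp only [τ, sympTransvection_inv]⟩)
  have hmul : Continuous fun g : GL (Fin n ⊕ Fin n) k => g * sympTransvection c' l' :=
    (IsRegularMap.id.mul (IsRegularMap.const _)).continuous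
  let ψ : CofiniteTopology {t : k // q.eval t ≠ 0} → evenOrthGroup k n := fun t =>
    ⟨τ (CofiniteTopology.of.symm t) * sympTransvection c' l',
      mul_mem (sympTransvection_mem_evenOrthGroup (by
        rw [← hq]
        exact inv_mul_cancel₀ (CofiniteTopology.of.symm t).2))
        (sympTransvection_mem_evenOrthGroup hl')⟩
  have hψ : Continuous ψ := (hmul.comp hcont).subtype_mk _
  have hψ0 : ψ (CofiniteTopology.of ⟨0, hq0⟩) = 1 := by
    refine Subtype.ext ?_
    have h0 : (q.eval 0)⁻¹ = l' := by
      rw [hq, zero_smul, add_zero]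
      exact (eq_inv_of_mul_eq_one_left hl').symm
    simp only [ψ, τ, Equiv.symm_apply_apply, h0, zero_smul, add_zero, sympTransvection_mul_self,
      OneMemClass.coe_one]
  have hψ1 : (ψ (CofiniteTopology.of ⟨1, hq1⟩) : GL (Fin n ⊕ Fin n) k) =
      sympTransvection c l * sympTransvection c' l' := by
    have h1 : (q.eval 1)⁻¹ = l := by
      rw [hq, hsum]
      exact (eq_inv_of_mul_eq_one_left hl).symm
    simp only [ψ, τ, Equiv.symm_apply_apply, h1, hsum]
  rw [← hψ1]
  refine Subgroup.subset_closure ⟨_, ?_, rfl⟩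
  exact (isPreconnected_range hψ).subset_connectedComponent ⟨_, hψ0⟩ ⟨_, rfl⟩

lemma evenSOGroup_le_evenOrthGroup : evenSOGroup k n ≤ evenOrthGroup k n := by
  rw [evenSOGroup, Subgroup.closure_le]
  rintro _ ⟨g, _, rfl⟩
  exact g.2

end Connectedness

section SingularImage

variable {k n}

lemma quadForm_nilPart_nilPart [CharP k 2] {g : GL (Fin n ⊕ Fin n) k}
    (hg : g ∈ evenOrthGroup k n) (hg3 : (g.1 - 1) ^ 3 = 0) (v : (Fin n ⊕ Fin n) → k) :
    quadForm k n (nilPart g (nilPart g v)) = 0 := by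
  have h (w : (Fin n ⊕ Fin n) → k) :
      quadForm k n (nilPart g w) + sympBilin w (nilPart g w) = 0 := by
    have := mem_evenOrthGroup_iff.1 hg w
    rwa [← add_nilPart, quadForm_add, add_assoc, add_eq_left] at this
  have hcross := (isometry_sq_identities sympBilin_isAlt
    (nilPart_isometry (evenOrthGroup_le_SpGroup hg)) (nilPart_cube hg3)).2.1 v v
  simpa [hcross] using h (nilPart g v)

end SingularImage

/-- Let `k` be an algebraically closed field of characteristic 2.
The unipotent conjugacy class with Jordan type `3² ⊕ 1^{2n-6}` in `Sp(2n, k)` (`n ≥ 3`),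
and likewise in `SO(2n, k)`, is not spherical. -/
theorem not_spherical_jordan_type_33_char_two
    (k : Type*) [Field k] [IsAlgClosed k] (hchar : ringChar k = 2)
    (n : ℕ) (hn : 3 ≤ n) :
    (∀ u : SpGroup k n, hasJordanType33 (SpGroup k n) u →
      ¬ IsSphericalClass (SpGroup k n) (conjClass u)) ∧
    (∀ u : evenSOGroup k n, hasJordanType33 (evenSOGroup k n) u →
      ¬ IsSphericalClass (evenSOGroup k n) (conjClass u)) := by
  have : CharP k 2 := ringChar.of_eq hchar
  have hinf : Infinite k := IsAlgClosed.instInfinite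
  have hne {N : Matrix (Fin n ⊕ Fin n) (Fin n ⊕ Fin n) k} (h : (N ^ 2).rank = 2) : N ^ 2 ≠ 0 := by
    intro h0
    rw [h0, Matrix.rank_zero] at h
    omega
  refine ⟨fun u hu hsph => ?_, fun u hu hsph => ?_⟩
  · obtain ⟨B, hB, x, hx, hcl⟩ := hsph
    have hle : B.map (SpGroup k n).subtype ≤ SpGroup k n := Subgroup.map_subtype_le B
    obtain ⟨W, hWiso, hW, hW2⟩ :=
      exists_isotropic_stable hle hB.hasCommonEigenvectors (d := 2) (by omega)
    exact not_subset_closure_conjOrbit le_rfl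
      hasExchangeTransvections_SpGroup.exists_translate
      (fun v₁ hv₁ v₂ hv₂ w₁ hw₁ w₂ hw₂ hv hw hvi hwi =>
        hasExchangeTransvections_SpGroup.exists_move_pair hw₁ hw₂ hv₁ hv₂ hw hv hwi hvi)
      hu.1 (hne hu.2.2) (fun _ => trivial) hW hW2 (fun _ _ => trivial) hWiso hx hcl
  · obtain ⟨B, hB, x, hx, hcl⟩ := hsph
    have hle : B.map (evenSOGroup k n).subtype ≤ evenOrthGroup k n :=
      (Subgroup.map_subtype_le B).trans evenSOGroup_le_evenOrthGroup
    obtain ⟨W, hW, hW2, hWiso, hWQ⟩ :=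
      exists_singular_stable_plane hn hle hB.hasCommonEigenvectors
    exact not_subset_closure_conjOrbit
      (evenSOGroup_le_evenOrthGroup.trans evenOrthGroup_le_SpGroup)
      hasExchangeTransvections_orth.exists_translate
      (fun v₁ hv₁ v₂ hv₂ w₁ hw₁ w₂ hw₂ hv hw hvi hwi =>
        exists_move_pair_orth hn transvection_mul_mem_evenSOGroup hw₁ hw₂ hv₁ hv₂ hw hv hwi hvi)
      hu.1 (hne hu.2.2) (quadForm_nilPart_nilPart (evenSOGroup_le_evenOrthGroup u.2) hu.1)
      hW hW2 hWQ hWiso hx hcl
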